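/- arXiv:1010.5081 — 15 statements merged into one kernel-verified Lean document; each statement's English description precedes it below -/
import Mathlib

section
/- Let a finite strategic game be β-nice with respect to f : Σ → ℝ≥0, and assume f(S) ≥ Σ_{i∈N} u_i(S) for every state S. Then for every α ≥ 0, every α-Nash equilibrium S satisfies OPT_f ≤ (α + β) · f(S) (i.e., the α-price of anarchy with respect to f is at most α + β). -/
/-- If a finite strategic game is β-nice with respect to `f`
and `f(S) ≥ ∑ i u_i(S)` for every state, then for every `α ≥ 0`, every
α-Nash equilibrium `S` satisfies `OPT_f ≤ (α + β) · f(S)`. -/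
theorem beta_nice_alpha_poa {n : ℕ} (Strat : Fin n → Type*) [∀ i, Fintype (Strat i)]
    [∀ i, Nonempty (Strat i)]
    (u : Fin n → (∀ i, Strat i) → ℝ) (hu : ∀ i S, 0 ≤ u i S)
    (f : (∀ i, Strat i) → ℝ) (hf : ∀ S, 0 ≤ f S)
    (β : ℝ)
    -- β-niceness: `β·f(S) + ∑ i Δ_i(S) ≥ OPT_f` for every state `S`
    (hnice : ∀ S : ∀ i, Strat i,
      β * f S + ∑ i, ((Finset.univ.sup' Finset.univ_nonempty
          fun s' : Strat i => u i (Function.update S i s')) - u i S)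
        ≥ Finset.univ.sup' Finset.univ_nonempty f)
    -- `f` dominates the social welfare
    (hsw : ∀ S : ∀ i, Strat i, f S ≥ ∑ i, u i S)
    (α : ℝ) (hα : 0 ≤ α)
    (S : ∀ i, Strat i)
    -- `S` is an α-Nash equilibrium
    (hNE : ∀ (i : Fin n) (s' : Strat i),
      (1 + α) * u i S ≥ u i (Function.update S i s')) :
    Finset.univ.sup' Finset.univ_nonempty f ≤ (α + β) * f S := by
  have hΔ : ∑ i, ((Finset.univ.sup' Finset.univ_nonempty
      fun s' : Strat i => u i (Function.update S i s')) - u i S) ≤ α * ∑ i, u i S := by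
    rw [Finset.mul_sum]
    refine Finset.sum_le_sum fun i _ => ?_
    have hsup : (Finset.univ.sup' Finset.univ_nonempty
        fun s' : Strat i => u i (Function.update S i s')) ≤ (1 + α) * u i S :=
      Finset.sup'_le _ _ fun s' _ => hNE i s'
    linarith
  have hαf : α * ∑ i, u i S ≤ α * f S := mul_le_mul_of_nonneg_left (hsw S) hα
  linarith [hnice S]
end

section
/- Let a ≥ 1, b > 0 and 0 < ε ≤ 1 be real numbers, and let g : ℕ → ℝ be a sequence with g(0) ≥ 0 such that g(k+1) − g(k) ≥ b − (1/a)·g(k) for every k ∈ ℕ. Then for every natural number t with t ≥ a·ln(1/ε), it holds that g(t) ≥ a·b·(1 − ε). -/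
/-- A sequence starting at a nonnegative value and gaining at least `b - g k / a` at each step
dominates the solution `a * b * (1 - (1 - 1 / a) ^ k)` of the corresponding recurrence. -/
lemma mul_one_sub_pow_le_of_step {a b : ℝ} (ha : 1 ≤ a) {g : ℕ → ℝ} (hg0 : 0 ≤ g 0)
    (hstep : ∀ k : ℕ, g (k + 1) - g k ≥ b - (1 / a) * g k) (k : ℕ) :
    a * b * (1 - (1 - 1 / a) ^ k) ≤ g k := by
  have hc : 0 ≤ 1 - 1 / a := sub_nonneg.mpr (div_le_one_of_le₀ ha (by linarith))
  have hb : a * b * (1 / a) = b := by field_simp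
  induction k with
  | zero => simpa using hg0
  | succ k ih =>
    calc a * b * (1 - (1 - 1 / a) ^ (k + 1))
        = a * b * (1 / a) + (1 - 1 / a) * (a * b * (1 - (1 - 1 / a) ^ k)) := by ring
      _ ≤ b + (1 - 1 / a) * g k := by rw [hb]; gcongr
      _ ≤ g (k + 1) := by linarith [hstep k]

/-- After `a * log (1 / ε)` steps, the geometric factor `1 - 1 / a` has decayed below `ε`. -/
lemma one_sub_one_div_pow_le {a ε : ℝ} (ha : 1 ≤ a) (hε : 0 < ε) {t : ℕ}
    (ht : a * Real.log (1 / ε) ≤ t) : (1 - 1 / a) ^ t ≤ ε := by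
  have ha0 : 0 < a := by linarith
  have hc : 0 ≤ 1 - 1 / a := sub_nonneg.mpr (div_le_one_of_le₀ ha ha0.le)
  have hlog : -Real.log ε ≤ t / a := by
    rw [le_div_iff₀ ha0]
    rw [one_div, Real.log_inv] at ht
    linarith
  calc (1 - 1 / a) ^ t ≤ Real.exp (-(1 / a)) ^ t := by
        gcongr
        exact Real.one_sub_le_exp_neg _
    _ = Real.exp (-(t / a)) := by rw [← Real.exp_nat_mul]; ring_nf
    _ ≤ Real.exp (Real.log ε) := Real.exp_le_exp.mpr (by linarith)
    _ = ε := Real.exp_log hε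

/-- Let `a ≥ 1`, `b > 0`, `0 < ε ≤ 1`, and let `g : ℕ → ℝ`
satisfy `g 0 ≥ 0` and `g (k+1) − g k ≥ b − (1/a)·g k` for all `k`.
Then for every `t : ℕ` with `t ≥ a·ln(1/ε)` it holds that `g t ≥ a·b·(1 − ε)`. -/
theorem sequence_convergence (a b ε : ℝ) (ha : 1 ≤ a) (hb : 0 < b)
    (hε0 : 0 < ε) (hε1 : ε ≤ 1)
    (g : ℕ → ℝ) (hg0 : 0 ≤ g 0)
    (hstep : ∀ k : ℕ, g (k + 1) - g k ≥ b - (1 / a) * g k)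
    (t : ℕ) (ht : (t : ℝ) ≥ a * Real.log (1 / ε)) :
    g t ≥ a * b * (1 - ε) := by
  refine le_trans ?_ (mul_one_sub_pow_le_of_step ha hg0 hstep t)
  have := one_sub_one_div_pow_le ha hε0 ht
  gcongr
end

section
/- Let a finite strategic game with potential function Φ : Σ → ℝ be perfect and β-nice with respect to f : Σ → ℝ≥0, where 0 < β ≤ n. Let S^0, S^1, S^2, … be a basic Nash dynamic, i.e., for every k ∈ ℕ either max_{j∈N} Δ_j(S^k) = 0 and S^{k+1} = S^k, or there exists a player i with Δ_i(S^k) = max_{j∈N} Δ_j(S^k) > 0 and a strategy s'_i ∈ Σ_i with u_i(S^k_{-i}, s'_i) = max_{s''∈Σ_i} u_i(S^k_{-i}, s'') such that S^{k+1} = (S^k_{-i}, s'_i). Then for every 0 < ε ≤ 1 and every natural number t with t ≥ (n/β)·ln(1/ε), it holds that f(S^t) ≥ (OPT_f / β)·(1 − ε). -/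
/-- The best-response payoff of player `i` in state `S`:
`max_{s' ∈ Σ_i} u_i(S_{-i}, s')`. -/
noncomputable def bestResp {n : ℕ} {Strat : Fin n → Type*} [∀ i, Fintype (Strat i)]
    [∀ i, Nonempty (Strat i)]
    (u : Fin n → (∀ i, Strat i) → ℝ) (S : ∀ i, Strat i) (i : Fin n) : ℝ :=
  Finset.univ.sup' Finset.univ_nonempty fun s' : Strat i => u i (Function.update S i s')

/-- `Δ_i(S) = max_{s' ∈ Σ_i} u_i(S_{-i}, s') − u_i(S)`. -/
noncomputable def delta {n : ℕ} {Strat : Fin n → Type*} [∀ i, Fintype (Strat i)]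
    [∀ i, Nonempty (Strat i)]
    (u : Fin n → (∀ i, Strat i) → ℝ) (S : ∀ i, Strat i) (i : Fin n) : ℝ :=
  bestResp u S i - u i S

/-- In a perfect β-nice potential game (`0 < β ≤ n`), the basic
Nash dynamic reaches, within any `t ≥ (n/β)·ln(1/ε)` steps, a state `S^t` with
`f(S^t) ≥ (OPT_f/β)·(1 − ε)`. -/
theorem basic_nash_dynamic_convergence {n : ℕ} [NeZero n]
    (Strat : Fin n → Type*) [∀ i, Fintype (Strat i)] [∀ i, Nonempty (Strat i)]
    (u : Fin n → (∀ i, Strat i) → ℝ) (hu : ∀ i S, 0 ≤ u i S)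
    (f Φ : (∀ i, Strat i) → ℝ) (hf : ∀ S, 0 ≤ f S)
    (β : ℝ) (hβ0 : 0 < β) (hβn : β ≤ n)
    -- perfectness (a): `f` dominates the social welfare
    (hperf1 : ∀ S : ∀ i, Strat i, f S ≥ ∑ i, u i S)
    -- perfectness (b): the sandwich property for improvement moves
    (hperf2 : ∀ (S : ∀ i, Strat i) (i : Fin n) (s' : Strat i),
      u i (Function.update S i s') > u i S →
      f (Function.update S i s') - f S ≥ Φ (Function.update S i s') - Φ S ∧
      Φ (Function.update S i s') - Φ S ≥ u i (Function.update S i s') - u i S)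
    -- β-niceness
    (hnice : ∀ S : ∀ i, Strat i,
      β * f S + ∑ i, delta u S i ≥ Finset.univ.sup' Finset.univ_nonempty f)
    -- `Sseq` is a basic Nash dynamic
    (Sseq : ℕ → ∀ i, Strat i)
    (hdyn : ∀ k : ℕ,
      ((∀ j, delta u (Sseq k) j = 0) ∧ Sseq (k + 1) = Sseq k) ∨
      (∃ (i : Fin n) (s' : Strat i),
        (∀ j, delta u (Sseq k) j ≤ delta u (Sseq k) i) ∧
        delta u (Sseq k) i > 0 ∧
        u i (Function.update (Sseq k) i s') = bestResp u (Sseq k) i ∧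
        Sseq (k + 1) = Function.update (Sseq k) i s')) :
    ∀ ε : ℝ, 0 < ε → ε ≤ 1 → ∀ t : ℕ,
      (t : ℝ) ≥ ((n : ℝ) / β) * Real.log (1 / ε) →
      f (Sseq t) ≥ (Finset.univ.sup' Finset.univ_nonempty f / β) * (1 - ε) := by
  set M : ℝ := Finset.univ.sup' Finset.univ_nonempty f with hM
  have hn : (0 : ℝ) < n := by exact_mod_cast Nat.pos_of_ne_zero (NeZero.ne n)
  have hM0 : 0 ≤ M := (hf (Sseq 0)).trans (Finset.le_sup' f (Finset.mem_univ (Sseq 0)))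
  -- one step shrinks the gap `M - β * f` by the factor `1 - β / n`
  have hstep (k : ℕ) : M - β * f (Sseq (k + 1)) ≤ (1 - β / n) * (M - β * f (Sseq k)) := by
    have hk := hnice (Sseq k)
    have hgain : (∑ i, delta u (Sseq k) i) / n ≤ f (Sseq (k + 1)) - f (Sseq k) := by
      rcases hdyn k with ⟨h0, hS⟩ | ⟨i, s', hmax, hpos, hbest, hS⟩
      · simp [h0, hS]
      · have hsum : ∑ j, delta u (Sseq k) j ≤ n * delta u (Sseq k) i := by
          simpa using Finset.sum_le_card_nsmul Finset.univ _ _ fun j _ => hmax j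
        have hdelta : delta u (Sseq k) i =
            u i (Function.update (Sseq k) i s') - u i (Sseq k) := by rw [hbest, delta]
        obtain ⟨h1, h2⟩ := hperf2 (Sseq k) i s' (by linarith)
        rw [hS, div_le_iff₀ hn]
        nlinarith
    have hgap : (M - β * f (Sseq k)) / n ≤ f (Sseq (k + 1)) - f (Sseq k) :=
      le_trans (by gcongr; linarith) hgain
    have := mul_le_mul_of_nonneg_left hgap hβ0.le
    calc M - β * f (Sseq (k + 1))
        ≤ M - β * f (Sseq k) - β * ((M - β * f (Sseq k)) / n) := by linarith
      _ = (1 - β / n) * (M - β * f (Sseq k)) := by ring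
  have hq : 0 ≤ 1 - β / n := sub_nonneg.2 ((div_le_one hn).2 hβn)
  have hgap (k : ℕ) : M - β * f (Sseq k) ≤ (1 - β / n) ^ k * M := by
    induction k with
    | zero =>
      have := mul_nonneg hβ0.le (hf (Sseq 0))
      simpa using this
    | succ k ih =>
      calc M - β * f (Sseq (k + 1)) ≤ (1 - β / n) * (M - β * f (Sseq k)) := hstep k
        _ ≤ (1 - β / n) * ((1 - β / n) ^ k * M) := by gcongr
        _ = (1 - β / n) ^ (k + 1) * M := by ring
  intro ε hε _ t ht
  have hpow : (1 - β / n) ^ t ≤ ε := by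
    calc (1 - β / n) ^ t ≤ Real.exp (-(β / n)) ^ t := by
          gcongr
          exact Real.one_sub_le_exp_neg _
      _ = Real.exp (t * -(β / n)) := (Real.exp_nat_mul _ _).symm
      _ ≤ Real.exp (Real.log ε) := by
          rw [Real.exp_le_exp]
          have h := mul_le_mul_of_nonneg_left ht (div_pos hβ0 hn).le
          rw [one_div, Real.log_inv] at h
          have h' : β / n * (n / β * -Real.log ε) = -Real.log ε := by field_simp
          linarith
      _ = ε := Real.exp_log hε
  have := hgap t
  have := mul_le_mul_of_nonneg_right hpow hM0
  rw [ge_iff_le, div_mul_eq_mul_div, div_le_iff₀ hβ0]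
  linarith
end

section
/- Let a finite strategic game with potential function Φ : Σ → ℝ be perfect and β-nice with respect to f : Σ → ℝ≥0, let α ≥ 0, and assume 0 < β + α ≤ n. For a state S, let U(S) = { i ∈ N : ∃ s'_i ∈ Σ_i with u_i(S_{-i}, s'_i) > (1+α)·u_i(S) } be the set of players having an α-improvement move. Let S^0, S^1, S^2, … be a basic α-Nash dynamic, i.e., for every k ∈ ℕ either U(S^k) = ∅ and S^{k+1} = S^k, or there exists a player i ∈ U(S^k) with Δ_i(S^k) = max_{j∈U(S^k)} Δ_j(S^k) and a strategy s'_i ∈ Σ_i with u_i(S^k_{-i}, s'_i) = max_{s''∈Σ_i} u_i(S^k_{-i}, s'') such that S^{k+1} = (S^k_{-i}, s'_i). Then for every 0 < ε ≤ 1 and every natural number t with t ≥ (n/(β+α))·ln(1/ε), it holds that f(S^t) ≥ (OPT_f / (β+α))·(1 − ε). -/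
/-- Player `i` has an α-improvement move in state `S`. -/
def hasAlphaImprovement {n : ℕ} {Strat : Fin n → Type*}
    (u : Fin n → (∀ i, Strat i) → ℝ) (α : ℝ) (S : ∀ i, Strat i) (i : Fin n) : Prop :=
  ∃ s' : Strat i, u i (Function.update S i s') > (1 + α) * u i S

/-- A player without an α-improvement move gains at most `α · u_i(S)` by deviating. -/
theorem delta_le_of_not_hasAlphaImprovement {n : ℕ} {Strat : Fin n → Type*}
    [∀ i, Fintype (Strat i)] [∀ i, Nonempty (Strat i)]
    {u : Fin n → (∀ i, Strat i) → ℝ} {α : ℝ} {S : ∀ i, Strat i} {i : Fin n}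
    (h : ¬ hasAlphaImprovement u α S i) : delta u S i ≤ α * u i S := by
  simp only [hasAlphaImprovement, not_exists, not_lt, gt_iff_lt] at h
  have hb : bestResp u S i ≤ (1 + α) * u i S := Finset.sup'_le _ _ fun s' _ => h s'
  unfold delta
  linarith

/-- A player with an α-improvement move has best-response payoff exceeding its current payoff. -/
theorem lt_bestResp_of_hasAlphaImprovement {n : ℕ} {Strat : Fin n → Type*}
    [∀ i, Fintype (Strat i)] [∀ i, Nonempty (Strat i)]
    {u : Fin n → (∀ i, Strat i) → ℝ} {α : ℝ} {S : ∀ i, Strat i} {i : Fin n}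
    (hα : 0 ≤ α) (hu : 0 ≤ u i S) (h : hasAlphaImprovement u α S i) :
    u i S < bestResp u S i := by
  obtain ⟨s', hs'⟩ := h
  have hb : u i (Function.update S i s') ≤ bestResp u S i :=
    Finset.le_sup' (fun s' => u i (Function.update S i s')) (Finset.mem_univ s')
  nlinarith [mul_nonneg hα hu]

/-- A sequence whose gap to `A ≥ 0` contracts by a factor `1 - c` in each step is within `ε * A`
of `A` after `t ≥ log (1 / ε) / c` steps. -/
theorem mul_one_sub_le_of_gap_contracts {x : ℕ → ℝ} {A c ε : ℝ} (hA : 0 ≤ A) (hx : 0 ≤ x 0)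
    (hc : c ≤ 1) (hstep : ∀ k, A - x (k + 1) ≤ (1 - c) * (A - x k)) (hε : 0 < ε) {t : ℕ}
    (ht : Real.log (1 / ε) ≤ c * t) : A * (1 - ε) ≤ x t := by
  have hgap : ∀ k, A - x k ≤ (1 - c) ^ k * A := by
    intro k
    induction k with
    | zero => simpa using hx
    | succ k ih =>
      calc A - x (k + 1) ≤ (1 - c) * (A - x k) := hstep k
        _ ≤ (1 - c) * ((1 - c) ^ k * A) := mul_le_mul_of_nonneg_left ih (by linarith)
        _ = (1 - c) ^ (k + 1) * A := by ring
  have hpow : (1 - c) ^ t ≤ ε :=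
    calc (1 - c) ^ t ≤ Real.exp (-c) ^ t :=
          pow_le_pow_left₀ (by linarith) (Real.one_sub_le_exp_neg c) t
      _ = Real.exp (-(c * t)) := by rw [← Real.exp_nat_mul]; ring_nf
      _ ≤ Real.exp (Real.log ε) := by
          rw [one_div, Real.log_inv] at ht
          exact Real.exp_le_exp.mpr (by linarith)
      _ = ε := Real.exp_log hε
  nlinarith [hgap t, mul_le_mul_of_nonneg_right hpow hA]

/-- In a perfect β-nice potential game, for `α ≥ 0` with
`0 < β + α ≤ n`, the basic α-Nash dynamic reaches, within any
`t ≥ (n/(β+α))·ln(1/ε)` steps, a state `S^t` with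
`f(S^t) ≥ (OPT_f/(β+α))·(1 − ε)`. -/
theorem basic_alpha_nash_dynamic_convergence {n : ℕ} [NeZero n]
    (Strat : Fin n → Type*) [∀ i, Fintype (Strat i)] [∀ i, Nonempty (Strat i)]
    (u : Fin n → (∀ i, Strat i) → ℝ) (hu : ∀ i S, 0 ≤ u i S)
    (f Φ : (∀ i, Strat i) → ℝ) (hf : ∀ S, 0 ≤ f S)
    (β α : ℝ) (hα : 0 ≤ α) (hβα0 : 0 < β + α) (hβαn : β + α ≤ n)
    -- perfectness (a): `f` dominates the social welfare
    (hperf1 : ∀ S : ∀ i, Strat i, f S ≥ ∑ i, u i S)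
    -- perfectness (b): the sandwich property for improvement moves
    (hperf2 : ∀ (S : ∀ i, Strat i) (i : Fin n) (s' : Strat i),
      u i (Function.update S i s') > u i S →
      f (Function.update S i s') - f S ≥ Φ (Function.update S i s') - Φ S ∧
      Φ (Function.update S i s') - Φ S ≥ u i (Function.update S i s') - u i S)
    -- β-niceness
    (hnice : ∀ S : ∀ i, Strat i,
      β * f S + ∑ i, delta u S i ≥ Finset.univ.sup' Finset.univ_nonempty f)
    -- `Sseq` is a basic α-Nash dynamic
    (Sseq : ℕ → ∀ i, Strat i)
    (hdyn : ∀ k : ℕ,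
      ((∀ i, ¬ hasAlphaImprovement u α (Sseq k) i) ∧ Sseq (k + 1) = Sseq k) ∨
      (∃ (i : Fin n) (s' : Strat i),
        hasAlphaImprovement u α (Sseq k) i ∧
        (∀ j, hasAlphaImprovement u α (Sseq k) j →
          delta u (Sseq k) j ≤ delta u (Sseq k) i) ∧
        u i (Function.update (Sseq k) i s') = bestResp u (Sseq k) i ∧
        Sseq (k + 1) = Function.update (Sseq k) i s')) :
    ∀ ε : ℝ, 0 < ε → ε ≤ 1 → ∀ t : ℕ,
      (t : ℝ) ≥ ((n : ℝ) / (β + α)) * Real.log (1 / ε) →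
      f (Sseq t) ≥ (Finset.univ.sup' Finset.univ_nonempty f / (β + α)) * (1 - ε) := by
  intro ε hε _ t ht
  set M := Finset.univ.sup' Finset.univ_nonempty f
  have hn : (0 : ℝ) < n := lt_of_lt_of_le hβα0 hβαn
  have hM : 0 ≤ M := (hf (Sseq 0)).trans (Finset.le_sup' f (Finset.mem_univ _))
  have hgain : ∀ k, ∃ D : ℝ, (∀ j, delta u (Sseq k) j ≤ D + α * u j (Sseq k)) ∧
      f (Sseq k) + D ≤ f (Sseq (k + 1)) := by
    intro k
    rcases hdyn k with ⟨hno, heq⟩ | ⟨i, s', hi, hmax, hbest, heq⟩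
    · refine ⟨0, fun j => ?_, by rw [heq, add_zero]⟩
      rw [zero_add]
      exact delta_le_of_not_hasAlphaImprovement (hno j)
    · have hlt := lt_bestResp_of_hasAlphaImprovement hα (hu i _) hi
      refine ⟨delta u (Sseq k) i, fun j => ?_, ?_⟩
      · have hpos : 0 ≤ α * u j (Sseq k) := mul_nonneg hα (hu j _)
        by_cases hj : hasAlphaImprovement u α (Sseq k) j
        · linarith [hmax j hj]
        · have hD : 0 ≤ delta u (Sseq k) i := (sub_pos.mpr hlt).le
          linarith [delta_le_of_not_hasAlphaImprovement hj]
      · obtain ⟨h1, h2⟩ := hperf2 (Sseq k) i s' (by rw [hbest]; exact hlt)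
        rw [hbest] at h2
        rw [heq]
        unfold delta
        linarith
  refine mul_one_sub_le_of_gap_contracts (x := fun k => f (Sseq k)) (c := (β + α) / n)
    (div_nonneg hM hβα0.le) (hf _) ((div_le_one hn).mpr hβαn) (fun k => ?_) hε ?_
  · obtain ⟨D, hD, hfD⟩ := hgain k
    have hsum : ∑ j, delta u (Sseq k) j ≤ n * D + α * ∑ j, u j (Sseq k) := by
      refine (Finset.sum_le_sum fun j _ => hD j).trans_eq ?_
      simp [Finset.sum_add_distrib, Finset.mul_sum]
    have hMD : M ≤ (β + α) * f (Sseq k) + n * D := by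
      linarith [hnice (Sseq k), mul_le_mul_of_nonneg_left (hperf1 (Sseq k)) hα]
    have hdiv : (M - (β + α) * f (Sseq k)) / n ≤ D := by
      rw [div_le_iff₀ hn]
      linarith
    have hexp : (1 - (β + α) / n) * (M / (β + α) - f (Sseq k)) =
        M / (β + α) - f (Sseq k) - (M - (β + α) * f (Sseq k)) / n := by
      field_simp
    rw [hexp]
    linarith
  · have hmul := mul_le_mul_of_nonneg_left ht (div_pos hβα0 hn).le
    rwa [← mul_assoc, div_mul_div_cancel₀ hn.ne', div_self hβα0.ne', one_mul] at hmul
end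

section
/- In every Fair Value game, the total profit is an exact potential function: for every state S : N → M, every player i and every party k ∈ M, it holds that tp(S_{-i}, k) − tp(S) = u_i(S_{-i}, k) − u_i(S). -/
/-- The set of players affiliated with party `j` in state `S`. -/
def Qset {n m : ℕ} (S : Fin n → Fin m) (j : Fin m) : Finset (Fin n) :=
  Finset.univ.filter fun i => S i = j

/-- Total profit of a state: `tp(S) = ∑_{j∈M} v_j(Q_j(S))`. -/
def totalProfit {n m : ℕ} (v : Fin m → Finset (Fin n) → ℝ) (S : Fin n → Fin m) : ℝ :=
  ∑ j, v j (Qset S j)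

/-- Fair Value payoff: player `i`'s marginal contribution to his own party,
`u_i(S) = v_{S(i)}(Q_{S(i)}(S)) − v_{S(i)}(Q_{S(i)}(S) \ {i})`. -/
def fvPayoff {n m : ℕ} (v : Fin m → Finset (Fin n) → ℝ) (S : Fin n → Fin m)
    (i : Fin n) : ℝ :=
  v (S i) (Qset S (S i)) - v (S i) (Qset S (S i) \ {i})

/-- Apart from player `i`, the parties do not depend on the choice of `i`. -/
theorem Qset_update_sdiff {n m : ℕ} (S : Fin n → Fin m) (i : Fin n) (k j : Fin m) :
    Qset (Function.update S i k) j \ {i} = Qset S j \ {i} := by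
  ext a
  by_cases h : a = i <;> simp [Qset, h]

/-- The total profit is the payoff of player `i` plus the total profit obtained without him. -/
theorem totalProfit_eq_fvPayoff_add {n m : ℕ} (v : Fin m → Finset (Fin n) → ℝ)
    (S : Fin n → Fin m) (i : Fin n) :
    totalProfit v S = fvPayoff v S i + ∑ j, v j (Qset S j \ {i}) := by
  rw [← sub_eq_iff_eq_add, totalProfit, fvPayoff, ← Finset.sum_sub_distrib]
  refine Finset.sum_eq_single (S i) (fun j _ hj => ?_) (by simp)
  rw [Finset.sdiff_eq_self_of_disjoint (by simpa [Qset] using hj.symm), sub_self]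

/-- In every Fair Value game the total profit is an exact
potential function: for every state `S`, player `i` and party `k`,
`tp(S_{-i}, k) − tp(S) = u_i(S_{-i}, k) − u_i(S)`. -/
theorem fairValue_exact_potential {n m : ℕ}
    (v : Fin m → Finset (Fin n) → ℝ)
    (hzero : ∀ j, v j ∅ = 0)
    (hmono : ∀ j (I J : Finset (Fin n)), I ⊆ J → v j I ≤ v j J)
    (hsub : ∀ j (I J : Finset (Fin n)), I ⊆ J → ∀ i ∉ J,
      v j (insert i I) - v j I ≥ v j (insert i J) - v j J)
    (S : Fin n → Fin m) (i : Fin n) (k : Fin m) :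
    totalProfit v (Function.update S i k) - totalProfit v S
      = fvPayoff v (Function.update S i k) i - fvPayoff v S i := by
  rw [totalProfit_eq_fvPayoff_add v (Function.update S i k) i, totalProfit_eq_fvPayoff_add v S i]
  simp only [Qset_update_sdiff]
  ring
end

section
/- Every Fair Value game is 2-nice with respect to the total profit: for every state S : N → M, it holds that 2·tp(S) + Σ_{i∈N} ( max_{k∈M} u_i(S_{-i}, k) − u_i(S) ) ≥ max_{S' : N → M} tp(S'). -/
/-- A submodular function grows along a union by at most the sum of the marginal contributions. -/
theorem submodular_union_sub_le_sum {α : Type*} [DecidableEq α] (f : Finset α → ℝ)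
    (hf : ∀ I J : Finset α, I ⊆ J → ∀ i ∉ J, f (insert i I) - f I ≥ f (insert i J) - f J)
    (A B : Finset α) : f (A ∪ B) - f A ≤ ∑ i ∈ B, (f (insert i A) - f A) := by
  induction B using Finset.induction_on with
  | empty => simp
  | insert b B hb ih =>
    rw [Finset.sum_insert hb, Finset.union_insert]
    by_cases hA : b ∈ A
    · rw [Finset.insert_eq_of_mem hA, Finset.insert_eq_of_mem (Finset.mem_union_left B hA)]
      linarith
    · have := hf A (A ∪ B) Finset.subset_union_left b (by simp [hA, hb])
      linarith

/-- The marginal contributions to `A` of the elements of a subset `B` of `A` sum to at most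
`f B - f ∅` when `f` is submodular. -/
theorem submodular_sum_sub_sdiff_le {α : Type*} [DecidableEq α] (f : Finset α → ℝ)
    (hf : ∀ I J : Finset α, I ⊆ J → ∀ i ∉ J, f (insert i I) - f I ≥ f (insert i J) - f J)
    (A B : Finset α) (hBA : B ⊆ A) : ∑ i ∈ B, (f A - f (A \ {i})) ≤ f B - f ∅ := by
  induction B using Finset.induction_on with
  | empty => simp
  | insert b B hb ih =>
    rw [Finset.sum_insert hb]
    obtain ⟨hbA, hBA⟩ := Finset.insert_subset_iff.mp hBA
    have h := hf B (A \ {b}) (by grind) b (by simp)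
    have hA : insert b (A \ {b}) = A := by grind
    rw [hA] at h
    linarith [ih hBA]

/-- A sum over players can be grouped by the party of each player. -/
theorem sum_Qset_eq_sum {n m : ℕ} (S : Fin n → Fin m) (g : Fin m → Fin n → ℝ) :
    ∑ j, ∑ i ∈ Qset S j, g j i = ∑ i, g (S i) i := by
  rw [← Finset.sum_fiberwise Finset.univ S]
  refine Finset.sum_congr rfl fun j _ => Finset.sum_congr rfl fun i hi => ?_
  rw [(Finset.mem_filter.mp hi).2]

/-- The payoffs in a Fair Value game sum to at most the total profit. -/
theorem sum_fvPayoff_le_totalProfit {n m : ℕ} (v : Fin m → Finset (Fin n) → ℝ)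
    (hzero : ∀ j, v j ∅ = 0)
    (hsub : ∀ j (I J : Finset (Fin n)), I ⊆ J → ∀ i ∉ J,
      v j (insert i I) - v j I ≥ v j (insert i J) - v j J)
    (S : Fin n → Fin m) : ∑ i, fvPayoff v S i ≤ totalProfit v S := by
  unfold fvPayoff totalProfit
  rw [← sum_Qset_eq_sum S fun j i => v j (Qset S j) - v j (Qset S j \ {i})]
  refine Finset.sum_le_sum fun j _ => ?_
  simpa [hzero j] using submodular_sum_sub_sdiff_le (v j) (hsub j) _ _ (Finset.Subset.refl _)

/-- A player who deviates to party `k` earns at least the increase in value caused by adding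
that player to the current members of `k`. -/
theorem insert_sub_le_fvPayoff_update {n m : ℕ} (v : Fin m → Finset (Fin n) → ℝ)
    (hmono : ∀ j (I J : Finset (Fin n)), I ⊆ J → v j I ≤ v j J)
    (S : Fin n → Fin m) (i : Fin n) (k : Fin m) :
    v k (insert i (Qset S k)) - v k (Qset S k) ≤ fvPayoff v (Function.update S i k) i := by
  have hQ : Qset (Function.update S i k) k = insert i (Qset S k) := by
    ext x
    by_cases hx : x = i <;> simp [Qset, Function.update_apply, hx]
  simp only [fvPayoff, Function.update_self, hQ]
  have := hmono k (insert i (Qset S k) \ {i}) (Qset S k) (by grind)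
  linarith

/-- The marginal contributions of the players to the parties they join in `S'` bound the
difference of total profits. -/
theorem totalProfit_sub_le_sum {n m : ℕ} (v : Fin m → Finset (Fin n) → ℝ)
    (hmono : ∀ j (I J : Finset (Fin n)), I ⊆ J → v j I ≤ v j J)
    (hsub : ∀ j (I J : Finset (Fin n)), I ⊆ J → ∀ i ∉ J,
      v j (insert i I) - v j I ≥ v j (insert i J) - v j J)
    (S S' : Fin n → Fin m) :
    totalProfit v S' - totalProfit v S ≤
      ∑ i, (v (S' i) (insert i (Qset S (S' i))) - v (S' i) (Qset S (S' i))) := by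
  unfold totalProfit
  rw [← sum_Qset_eq_sum S' fun j i => v j (insert i (Qset S j)) - v j (Qset S j),
    ← Finset.sum_sub_distrib]
  refine Finset.sum_le_sum fun j _ => ?_
  have h := submodular_union_sub_le_sum (v j) (hsub j) (Qset S j) (Qset S' j)
  have := hmono j (Qset S' j) (Qset S j ∪ Qset S' j) Finset.subset_union_right
  linarith

/-- Every Fair Value game is 2-nice with respect to the total
profit: for every state `S`,
`2·tp(S) + ∑_i (max_k u_i(S_{-i},k) − u_i(S)) ≥ max_{S'} tp(S')`. -/
theorem fairValue_two_nice {n m : ℕ} [NeZero m]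
    (v : Fin m → Finset (Fin n) → ℝ)
    (hzero : ∀ j, v j ∅ = 0)
    (hmono : ∀ j (I J : Finset (Fin n)), I ⊆ J → v j I ≤ v j J)
    (hsub : ∀ j (I J : Finset (Fin n)), I ⊆ J → ∀ i ∉ J,
      v j (insert i I) - v j I ≥ v j (insert i J) - v j J)
    (S : Fin n → Fin m) :
    2 * totalProfit v S
      + ∑ i, ((Finset.univ.sup' Finset.univ_nonempty
          fun k : Fin m => fvPayoff v (Function.update S i k) i) - fvPayoff v S i)
      ≥ Finset.univ.sup' Finset.univ_nonempty (totalProfit v) := by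
  refine Finset.sup'_le _ _ fun S' _ => ?_
  rw [Finset.sum_sub_distrib]
  have hdev : ∑ i, (v (S' i) (insert i (Qset S (S' i))) - v (S' i) (Qset S (S' i))) ≤
      ∑ i, Finset.univ.sup' Finset.univ_nonempty
        fun k : Fin m => fvPayoff v (Function.update S i k) i :=
    Finset.sum_le_sum fun i _ => (insert_sub_le_fvPayoff_update v hmono S i (S' i)).trans
      (Finset.le_sup' (fun k : Fin m => fvPayoff v (Function.update S i k) i)
        (Finset.mem_univ (S' i)))
  linarith [sum_fvPayoff_le_totalProfit v hzero hsub S, totalProfit_sub_le_sum v hmono hsub S S']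
end

section
/- In every Fair Value game, the price of anarchy with respect to the total profit is at most 2: if a state S : N → M is a Nash equilibrium, i.e., u_i(S) ≥ u_i(S_{-i}, k) for every player i and every party k ∈ M, then tp(S') ≤ 2·tp(S) for every state S' : N → M. -/
/-- Adjoining `B` to `A` raises a submodular function by at most the sum of any nonnegative
bounds on the increments over `A` of the elements of `B`. -/
theorem submodular_union_le_add_sum {α : Type*} [DecidableEq α] (w : Finset α → ℝ)
    (hsub : ∀ I J : Finset α, I ⊆ J → ∀ i ∉ J,
      w (insert i I) - w I ≥ w (insert i J) - w J)
    (A B : Finset α) (c : α → ℝ) (hc : ∀ i, 0 ≤ c i)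
    (h : ∀ i ∈ B, i ∉ A → w (insert i A) - w A ≤ c i) :
    w (A ∪ B) ≤ w A + ∑ i ∈ B, c i := by
  induction B using Finset.induction_on with
  | empty => simp
  | insert b B hb ih =>
    have ih' := ih fun i hi => h i (Finset.mem_insert_of_mem hi)
    rw [Finset.sum_insert hb, Finset.union_insert]
    by_cases hmem : b ∈ A ∪ B
    · rw [Finset.insert_eq_of_mem hmem]
      linarith [hc b]
    · have h₁ := hsub A (A ∪ B) Finset.subset_union_left b hmem
      have h₂ := h b (Finset.mem_insert_self b B)
        fun hA => hmem (Finset.mem_union_left B hA)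
      linarith

/-- The marginal contributions to `A` of the elements of `B ⊆ A` sum to at most
`w B - w ∅` when `w` is submodular. -/
theorem submodular_sum_marginal_le {α : Type*} [DecidableEq α] (w : Finset α → ℝ)
    (hsub : ∀ I J : Finset α, I ⊆ J → ∀ i ∉ J,
      w (insert i I) - w I ≥ w (insert i J) - w J)
    (A B : Finset α) (hBA : B ⊆ A) :
    ∑ i ∈ B, (w A - w (A \ {i})) ≤ w B - w ∅ := by
  induction B using Finset.induction_on with
  | empty => simp
  | insert b B hb ih =>
    obtain ⟨hbA, hB⟩ := Finset.insert_subset_iff.mp hBA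
    have hsubset : B ⊆ A \ {b} := by
      rw [Finset.sdiff_singleton_eq_erase]
      exact Finset.subset_erase.mpr ⟨hB, hb⟩
    have h₁ := hsub B (A \ {b}) hsubset b (by simp)
    rw [Finset.sdiff_singleton_eq_erase, Finset.insert_erase hbA,
      ← Finset.sdiff_singleton_eq_erase] at h₁
    rw [Finset.sum_insert hb]
    linarith [ih hB]

theorem sum_sum_Qset {n m : ℕ} (S : Fin n → Fin m) (f : Fin n → ℝ) :
    ∑ j, ∑ i ∈ Qset S j, f i = ∑ i, f i :=
  Finset.sum_fiberwise Finset.univ S f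

/-- A player who moves to a new party receives his increment over its members. -/
theorem fvPayoff_update {n m : ℕ} (v : Fin m → Finset (Fin n) → ℝ) (S : Fin n → Fin m)
    {i : Fin n} {k : Fin m} (hi : i ∉ Qset S k) :
    fvPayoff v (Function.update S i k) i
      = v k (insert i (Qset S k)) - v k (Qset S k) := by
  have hQ : Qset (Function.update S i k) k = insert i (Qset S k) := by
    ext x
    by_cases hx : x = i
    · subst hx; simp [Qset]
    · simp [Qset, hx]
  simp only [fvPayoff, Function.update_self, hQ]
  rw [Finset.sdiff_singleton_eq_erase, Finset.erase_insert hi]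

/-- In every Fair Value game the price of anarchy with respect
to the total profit is at most 2: if `S` is a Nash equilibrium then
`tp(S') ≤ 2·tp(S)` for every state `S'`. -/
theorem fairValue_poa_two {n m : ℕ}
    (v : Fin m → Finset (Fin n) → ℝ)
    (hzero : ∀ j, v j ∅ = 0)
    (hmono : ∀ j (I J : Finset (Fin n)), I ⊆ J → v j I ≤ v j J)
    (hsub : ∀ j (I J : Finset (Fin n)), I ⊆ J → ∀ i ∉ J,
      v j (insert i I) - v j I ≥ v j (insert i J) - v j J)
    (S : Fin n → Fin m)
    (hNE : ∀ (i : Fin n) (k : Fin m),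
      fvPayoff v S i ≥ fvPayoff v (Function.update S i k) i) :
    ∀ S' : Fin n → Fin m, totalProfit v S' ≤ 2 * totalProfit v S := by
  intro S'
  have hnonneg (i : Fin n) : 0 ≤ fvPayoff v S i :=
    sub_nonneg.mpr (hmono _ _ _ Finset.sdiff_subset)
  have hparty (j : Fin m) :
      v j (Qset S' j) ≤ v j (Qset S j) + ∑ i ∈ Qset S' j, fvPayoff v S i :=
    (hmono j _ _ Finset.subset_union_right).trans <|
      submodular_union_le_add_sum (v j) (hsub j) _ _ _ hnonneg fun i _ hi =>
        (fvPayoff_update v S hi).symm.trans_le (hNE i j)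
  have hpayoff (j : Fin m) : ∑ i ∈ Qset S j, fvPayoff v S i ≤ v j (Qset S j) := by
    have h := submodular_sum_marginal_le (v j) (hsub j) _ _ (Finset.Subset.refl (Qset S j))
    rw [hzero j, sub_zero] at h
    refine (Finset.sum_congr rfl fun i hi => ?_).trans_le h
    obtain rfl : S i = j := (Finset.mem_filter.mp hi).2
    rfl
  calc totalProfit v S'
      ≤ ∑ j, (v j (Qset S j) + ∑ i ∈ Qset S' j, fvPayoff v S i) :=
        Finset.sum_le_sum fun j _ => hparty j
    _ = totalProfit v S + ∑ j, ∑ i ∈ Qset S j, fvPayoff v S i := by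
        rw [Finset.sum_add_distrib, sum_sum_Qset, sum_sum_Qset, totalProfit]
    _ ≤ totalProfit v S + totalProfit v S :=
        add_le_add_right (Finset.sum_le_sum fun j _ => hpayoff j) _
    _ = 2 * totalProfit v S := (two_mul _).symm
end

section
/- Guaranteed payoff in Labor Union games: let (s,π) be a state of a Labor Union game, let i' be a player, and let (s',π') be the state obtained from (s,π) by a single move of player i' to an arbitrary target k ∈ M ∪ {⊥}. Then for every player i ≠ i', the payoff of i does not decrease: u_i(s',π') ≥ u_i(s,π). -/
/-- `P_j`: the set of players affiliated with party `j` (strategy `⊥` is `none`). -/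
def luP {n m : ℕ} (s : Fin n → Option (Fin m)) (j : Fin m) : Finset (Fin n) :=
  Finset.univ.filter fun i => s i = some j

/-- `P_j(i)`: the players of party `j` that arrived before `i`. -/
def luPred {n m : ℕ} (s : Fin n → Option (Fin m)) (π : Fin n → ℕ)
    (j : Fin m) (i : Fin n) : Finset (Fin n) :=
  Finset.univ.filter fun i' => s i' = some j ∧ π i' < π i

/-- Labor Union payoff: `u_i(s,π) = 0` if `s i = ⊥`, and
`u_i(s,π) = v_j(P_j(i) ∪ {i}) − v_j(P_j(i))` if `s i = j`. -/
def luPayoff {n m : ℕ} (v : Fin m → Finset (Fin n) → ℝ)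
    (s : Fin n → Option (Fin m)) (π : Fin n → ℕ) (i : Fin n) : ℝ :=
  match s i with
  | none => 0
  | some j => v j (luPred s π j i ∪ {i}) - v j (luPred s π j i)

/-- Total profit of a state: `tp(s,π) = ∑_{j∈M} v_j(P_j)`. -/
def luTp {n m : ℕ} (v : Fin m → Finset (Fin n) → ℝ)
    (s : Fin n → Option (Fin m)) : ℝ :=
  ∑ j, v j (luP s j)

/-- A single move of player `i` to target `k ∈ M ∪ {⊥}` transforms `(s,π)` into
`(s',π')`: `i`'s strategy becomes `k`, everyone else is unchanged, and `i` is
appended last (`π' i > π i'` for all `i' ≠ i`). -/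
def LUMove {n m : ℕ} (i : Fin n) (k : Option (Fin m))
    (s : Fin n → Option (Fin m)) (π : Fin n → ℕ)
    (s' : Fin n → Option (Fin m)) (π' : Fin n → ℕ) : Prop :=
  s' i = k ∧ (∀ i', i' ≠ i → s' i' = s i' ∧ π' i' = π i') ∧
    (∀ i', i' ≠ i → π i' < π' i)

/-- **guaranteed payoff.** If `(s',π')` is obtained from `(s,π)`
by a single move of player `i'` to an arbitrary target `k`, then the payoff of
every other player `i ≠ i'` does not decrease. -/
theorem laborUnion_guaranteed_payoff {n m : ℕ}
    (v : Fin m → Finset (Fin n) → ℝ)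
    (hzero : ∀ j, v j ∅ = 0)
    (hmono : ∀ j (I J : Finset (Fin n)), I ⊆ J → v j I ≤ v j J)
    (hsub : ∀ j (I J : Finset (Fin n)), I ⊆ J → ∀ i ∉ J,
      v j (insert i I) - v j I ≥ v j (insert i J) - v j J)
    (s : Fin n → Option (Fin m)) (π : Fin n → ℕ) (hπ : Function.Injective π)
    (i' : Fin n) (k : Option (Fin m))
    (s' : Fin n → Option (Fin m)) (π' : Fin n → ℕ)
    (hmove : LUMove i' k s π s' π')
    (i : Fin n) (hne : i ≠ i') :
    luPayoff v s' π' i ≥ luPayoff v s π i := by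
  obtain ⟨-, hkeep, hlast⟩ := hmove
  have hpred : ∀ j, luPred s' π' j i ⊆ luPred s π j i := by
    intro j a ha
    simp only [luPred, Finset.mem_filter, Finset.mem_univ, true_and] at ha ⊢
    rw [(hkeep i hne).2] at ha
    have hai : a ≠ i' := by
      rintro rfl
      exact lt_asymm ha.2 (hlast i hne)
    rwa [(hkeep a hai).1, (hkeep a hai).2] at ha
  unfold luPayoff
  rw [(hkeep i hne).1]
  cases s i with
  | none => exact le_rfl
  | some j =>
    simp only [Finset.union_singleton]
    exact hsub j _ _ (hpred j) i (by simp [luPred])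
end

section
/- Every Labor Union game is 2-nice with respect to the total profit: for every state (s,π), it holds that 2·tp(s,π) + Σ_{i∈N} Δ_i(s,π) ≥ OPT, where Δ_i(s,π) is the maximum, over the option of staying put and over all single moves of player i to any target k ∈ M ∪ {⊥}, of the resulting payoff of i minus u_i(s,π). -/
/-- The other members of party `j` (excluding player `i`). -/
def luOthers {n m : ℕ} (s : Fin n → Option (Fin m)) (i : Fin n) (j : Fin m) :
    Finset (Fin n) :=
  Finset.univ.filter fun i' => i' ≠ i ∧ s i' = some j

/-- The payoff player `i` would receive after a single move to target `k`
(he is appended last, so his predecessors are all other current members). -/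
def luMovedPayoff {n m : ℕ} (v : Fin m → Finset (Fin n) → ℝ)
    (s : Fin n → Option (Fin m)) (i : Fin n) (k : Option (Fin m)) : ℝ :=
  match k with
  | none => 0
  | some j => v j (luOthers s i j ∪ {i}) - v j (luOthers s i j)

/-- `Δ_i(s,π)`: the maximum, over staying put and over all single moves of `i`,
of the resulting payoff of `i` minus his current payoff. -/
noncomputable def luDelta {n m : ℕ} (v : Fin m → Finset (Fin n) → ℝ)
    (s : Fin n → Option (Fin m)) (π : Fin n → ℕ) (i : Fin n) : ℝ :=
  max (luPayoff v s π i)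
    (Finset.univ.sup' Finset.univ_nonempty
      fun k : Option (Fin m) => luMovedPayoff v s i k)
  - luPayoff v s π i

theorem sum_option_elim_eq_sum_luP {n m : ℕ} (s : Fin n → Option (Fin m))
    (g : Fin m → Fin n → ℝ) :
    ∑ i, (s i).elim 0 (fun j => g j i) = ∑ j, ∑ i ∈ luP s j, g j i := by
  simp only [luP, Finset.sum_filter]
  rw [Finset.sum_comm]
  refine Finset.sum_congr rfl fun i _ => ?_
  cases s i <;> simp

theorem union_sub_le_sum_marginal {α : Type*} [DecidableEq α] (f : Finset α → ℝ)
    (hsub : ∀ I J : Finset α, I ⊆ J → ∀ i ∉ J, f (insert i I) - f I ≥ f (insert i J) - f J)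
    (A B : Finset α) :
    f (A ∪ B) - f A ≤ ∑ i ∈ B, (f (insert i A) - f A) := by
  induction B using Finset.induction_on with
  | empty => simp
  | insert a B ha ih =>
    rw [Finset.sum_insert ha, Finset.union_insert]
    by_cases h : a ∈ A
    · rw [Finset.insert_eq_of_mem (Finset.mem_union_left B h), Finset.insert_eq_of_mem h]
      linarith
    · have h' : a ∉ A ∪ B := by simp [h, ha]
      linarith [hsub A (A ∪ B) Finset.subset_union_left a h']

theorem sum_marginal_of_injective {α : Type*} [DecidableEq α] (f : Finset α → ℝ)
    (π : α → ℕ) (hπ : Function.Injective π) (P : Finset α) :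
    ∑ i ∈ P, (f (insert i (P.filter fun k => π k < π i)) - f (P.filter fun k => π k < π i))
      = f P - f ∅ := by
  induction P using Finset.induction_on_max_value π with
  | empty => simp
  | insert a P ha hmax ih =>
    have hlast : ((insert a P).filter fun k => π k < π a) = P := by
      ext k
      simp only [Finset.mem_filter, Finset.mem_insert]
      refine ⟨?_, fun hk => ⟨Or.inr hk, lt_of_le_of_ne (hmax k hk) fun h => ha (hπ h ▸ hk)⟩⟩
      rintro ⟨rfl | hk, hlt⟩
      · exact absurd hlt (lt_irrefl _)
      · exact hk
    have hrest : ∀ i ∈ P, ((insert a P).filter fun k => π k < π i)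
        = P.filter fun k => π k < π i := fun i hi => by
      rw [Finset.filter_insert, if_neg (hmax i hi).not_gt]
    rw [Finset.sum_insert ha, hlast,
      Finset.sum_congr rfl fun i hi => by rw [hrest i hi], ih]
    ring

theorem sum_luPayoff_eq_luTp {n m : ℕ} (v : Fin m → Finset (Fin n) → ℝ)
    (hzero : ∀ j, v j ∅ = 0) (s : Fin n → Option (Fin m)) (π : Fin n → ℕ)
    (hπ : Function.Injective π) :
    ∑ i, luPayoff v s π i = luTp v s := by
  have hpayoff : ∀ i, luPayoff v s π i = (s i).elim 0
      (fun j => v j (insert i (luPred s π j i)) - v j (luPred s π j i)) := fun i => by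
    unfold luPayoff
    cases s i <;> simp
  have hpred : ∀ j i, luPred s π j i = (luP s j).filter fun k => π k < π i := fun j i => by
    simp [luPred, luP, Finset.filter_filter]
  simp only [hpayoff]
  rw [sum_option_elim_eq_sum_luP s
    fun j i => v j (insert i (luPred s π j i)) - v j (luPred s π j i)]
  simp only [hpred, sum_marginal_of_injective _ π hπ, hzero, sub_zero, luTp]

theorem luMovedPayoff_le_luDelta_add_luPayoff {n m : ℕ} (v : Fin m → Finset (Fin n) → ℝ)
    (s : Fin n → Option (Fin m)) (π : Fin n → ℕ) (i : Fin n) (k : Option (Fin m)) :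
    luMovedPayoff v s i k ≤ luDelta v s π i + luPayoff v s π i := by
  rw [luDelta, sub_add_cancel]
  exact le_max_of_le_right
    (Finset.le_sup' (fun k => luMovedPayoff v s i k) (Finset.mem_univ k))

theorem marginal_luP_le_luMovedPayoff {n m : ℕ} (v : Fin m → Finset (Fin n) → ℝ)
    (hmono : ∀ j (I J : Finset (Fin n)), I ⊆ J → v j I ≤ v j J)
    (s : Fin n → Option (Fin m)) (i : Fin n) (j : Fin m) :
    v j (insert i (luP s j)) - v j (luP s j) ≤ luMovedPayoff v s i (some j) := by
  have hothers : luOthers s i j = (luP s j).erase i := by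
    ext k
    simp [luOthers, luP]
  simp only [luMovedPayoff, hothers]
  by_cases hi : i ∈ luP s j
  · rw [Finset.insert_eq_of_mem hi, sub_self, sub_nonneg]
    exact hmono j _ _ Finset.subset_union_left
  · rw [Finset.erase_eq_of_notMem hi, Finset.union_comm, ← Finset.insert_eq]

/-- Every Labor Union game is 2-nice with respect to the
total profit: for every state `(s,π)`, `2·tp(s,π) + ∑_i Δ_i(s,π) ≥ OPT`. -/
theorem laborUnion_two_nice {n m : ℕ}
    (v : Fin m → Finset (Fin n) → ℝ)
    (hzero : ∀ j, v j ∅ = 0)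
    (hmono : ∀ j (I J : Finset (Fin n)), I ⊆ J → v j I ≤ v j J)
    (hsub : ∀ j (I J : Finset (Fin n)), I ⊆ J → ∀ i ∉ J,
      v j (insert i I) - v j I ≥ v j (insert i J) - v j J)
    (s : Fin n → Option (Fin m)) (π : Fin n → ℕ) (hπ : Function.Injective π) :
    2 * luTp v s + ∑ i, luDelta v s π i
      ≥ Finset.univ.sup' Finset.univ_nonempty (luTp v) := by
  refine Finset.sup'_le _ _ fun t _ => ?_
  have hparty : ∀ j, v j (luP t j) - v j (luP s j)
      ≤ ∑ i ∈ luP t j, (v j (insert i (luP s j)) - v j (luP s j)) := fun j =>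
    (sub_le_sub_right (hmono j _ _ Finset.subset_union_right) _).trans
      (union_sub_le_sum_marginal (v j) (hsub j) (luP s j) (luP t j))
  have hplayer : ∀ i, (t i).elim 0 (fun j => v j (insert i (luP s j)) - v j (luP s j))
      ≤ luDelta v s π i + luPayoff v s π i := fun i => by
    refine le_trans ?_ (luMovedPayoff_le_luDelta_add_luPayoff v s π i (t i))
    cases t i with
    | none => exact le_rfl
    | some j => exact marginal_luP_le_luMovedPayoff v hmono s i j
  have hdev : luTp v t - luTp v s ≤ ∑ i, (luDelta v s π i + luPayoff v s π i) := by
    rw [luTp, luTp, ← Finset.sum_sub_distrib]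
    refine (Finset.sum_le_sum fun j _ => hparty j).trans ?_
    rw [← sum_option_elim_eq_sum_luP t
      fun j i => v j (insert i (luP s j)) - v j (luP s j)]
    exact Finset.sum_le_sum fun i _ => hplayer i
  rw [Finset.sum_add_distrib, sum_luPayoff_eq_luTp v hzero s π hπ] at hdev
  linarith
end

section
/- In every Labor Union game, any total-profit-maximizing state is a strong Nash equilibrium (the strong price of stability is 1): let (s,π) be a state with tp(s,π) ≥ tp(s'',π'') for all states (s'',π''), let I ⊆ N be any coalition, and let (s',π') be any state such that s'(i) = s(i) and π'(i) = π(i) for every i ∉ I, and π'(i) > π(i'') for every i ∈ I and every i'' ∉ I (all deviators are appended after all non-deviators). If u_i(s',π') > u_i(s,π) for some i ∈ I, then u_j(s',π') < u_j(s,π) for some j ∈ I. -/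
/-- The marginal contributions of the members of `S`, in order of arrival, sum to the value
of `S`. -/
theorem sum_marginal_eq {α : Type*} [DecidableEq α] (f : Finset α → ℝ) (hf : f ∅ = 0)
    (π : α → ℕ) (hπ : Function.Injective π) (S : Finset α) :
    ∑ i ∈ S, (f (S.filter (fun k => π k < π i) ∪ {i}) - f (S.filter fun k => π k < π i))
      = f S := by
  induction S using Finset.induction_on_max_value π with
  | empty => simp [hf]
  | insert a S ha hmax ih =>
    have hlt : ∀ k ∈ S, π k < π a := fun k hk =>
      lt_of_le_of_ne (hmax k hk) fun h => ha (hπ h ▸ hk)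
    have h_filter_self : (insert a S).filter (fun k => π k < π a) = S := by
      ext k
      simp only [Finset.mem_filter, Finset.mem_insert]
      constructor
      · rintro ⟨rfl | hk, h⟩
        · exact absurd h (lt_irrefl _)
        · exact hk
      · exact fun hk => ⟨Or.inr hk, hlt k hk⟩
    have h_filter : ∀ i ∈ S, (insert a S).filter (fun k => π k < π i)
        = S.filter fun k => π k < π i := fun i hi => by
      rw [Finset.filter_insert, if_neg (not_lt.2 (hmax i hi))]
    rw [Finset.sum_insert ha, h_filter_self, Finset.sum_congr rfl fun i hi => by
      rw [h_filter i hi], ih, Finset.union_comm, ← Finset.insert_eq]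
    ring

/-- A player who keeps his party and loses predecessors does not lose payoff. -/
theorem luPayoff_le_of_luPred_subset {n m : ℕ} (v : Fin m → Finset (Fin n) → ℝ)
    (hsub : ∀ j (I J : Finset (Fin n)), I ⊆ J → ∀ i ∉ J,
      v j (insert i I) - v j I ≥ v j (insert i J) - v j J)
    {s s' : Fin n → Option (Fin m)} {π π' : Fin n → ℕ} {i : Fin n} (hs : s' i = s i)
    (hpred : ∀ j, luPred s' π' j i ⊆ luPred s π j i) :
    luPayoff v s π i ≤ luPayoff v s' π' i := by
  unfold luPayoff
  rw [hs]
  cases s i with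
  | none => exact le_rfl
  | some j =>
    simp only [Finset.union_comm _ {i}, ← Finset.insert_eq]
    exact hsub j _ _ (hpred j) i (by simp [luPred])

/-- In every Labor Union game, any total-profit-maximizing
state is a strong Nash equilibrium: if a coalition `I` deviates (all deviators
are appended after all non-deviators) and some deviator strictly gains, then
some deviator strictly loses. -/
theorem laborUnion_strong_pos_one {n m : ℕ}
    (v : Fin m → Finset (Fin n) → ℝ)
    (hzero : ∀ j, v j ∅ = 0)
    (hmono : ∀ j (I J : Finset (Fin n)), I ⊆ J → v j I ≤ v j J)
    (hsub : ∀ j (I J : Finset (Fin n)), I ⊆ J → ∀ i ∉ J,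
      v j (insert i I) - v j I ≥ v j (insert i J) - v j J)
    (s : Fin n → Option (Fin m)) (π : Fin n → ℕ) (hπ : Function.Injective π)
    -- `(s,π)` maximizes the total profit over all states
    (hopt : ∀ (s'' : Fin n → Option (Fin m)) (π'' : Fin n → ℕ),
      Function.Injective π'' → luTp v s'' ≤ luTp v s)
    (I : Finset (Fin n))
    (s' : Fin n → Option (Fin m)) (π' : Fin n → ℕ) (hπ' : Function.Injective π')
    (hfix : ∀ i ∉ I, s' i = s i ∧ π' i = π i)
    (happ : ∀ i ∈ I, ∀ i'' ∉ I, π i'' < π' i)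
    (hgain : ∃ i ∈ I, luPayoff v s' π' i > luPayoff v s π i) :
    ∃ j ∈ I, luPayoff v s' π' j < luPayoff v s π j := by
  by_contra! hcon
  obtain ⟨i, hi, hlt⟩ := hgain
  have hle : ∀ k, luPayoff v s π k ≤ luPayoff v s' π' k := fun k => by
    by_cases hk : k ∈ I
    · exact hcon k hk
    · refine luPayoff_le_of_luPred_subset v hsub (hfix k hk).1 fun j l hl => ?_
      simp only [luPred, Finset.mem_filter, Finset.mem_univ, true_and, (hfix k hk).2] at hl ⊢
      by_cases hlI : l ∈ I
      · exact absurd hl.2 (happ l hlI k hk).not_gt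
      · rwa [(hfix l hlI).1, (hfix l hlI).2] at hl
  have hsum := Finset.sum_lt_sum (fun k _ => hle k) ⟨i, Finset.mem_univ i, hlt⟩
  rw [sum_luPayoff_eq_luTp v hzero s π hπ, sum_luPayoff_eq_luTp v hzero s' π' hπ'] at hsum
  exact (hopt s' π' hπ').not_gt hsum
end

section
/- Fast convergence of the α-Nash dynamic in Labor Union games: let α > 0, let W ≥ 1 satisfy v_j(Q) ≤ W for every j ∈ M and Q ⊆ N, and consider a sequence of states (s^0,π^0), (s^1,π^1), …, (s^T,π^T) of a Labor Union game such that s^0(i) ∈ M and u_i(s^0,π^0) ≥ 1 for every player i, and such that each step is an α-improvement move: (s^{k+1},π^{k+1}) is obtained from (s^k,π^k) by a single move of some player i_k with u_{i_k}(s^{k+1},π^{k+1}) > (1+α)·u_{i_k}(s^k,π^k). Then T ≤ n·ln(W)/ln(1+α). -/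
/-- A move, appended last, never lowers the payoff of another player. -/
theorem luPayoff_le_of_move {n m : ℕ} (v : Fin m → Finset (Fin n) → ℝ)
    (hsub : ∀ j (I J : Finset (Fin n)), I ⊆ J → ∀ i ∉ J,
      v j (insert i I) - v j I ≥ v j (insert i J) - v j J)
    {s s' : Fin n → Option (Fin m)} {π π' : Fin n → ℕ} {i : Fin n} {k : Option (Fin m)}
    (hmove : LUMove i k s π s' π') {a : Fin n} (ha : a ≠ i) :
    luPayoff v s π a ≤ luPayoff v s' π' a := by
  obtain ⟨-, hother, hlast⟩ := hmove
  obtain ⟨hs, hπ⟩ := hother a ha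
  unfold luPayoff
  rw [hs]
  cases s a with
  | none => exact le_rfl
  | some j =>
    have hsubset : luPred s' π' j a ⊆ luPred s π j a := by
      intro b hb
      simp only [luPred, Finset.mem_filter, Finset.mem_univ, true_and] at hb ⊢
      have hbi : b ≠ i := by
        rintro rfl
        have := hlast a ha
        omega
      obtain ⟨hsb, hπb⟩ := hother b hbi
      rw [← hsb, ← hπb, ← hπ]
      exact hb
    have hnot : a ∉ luPred s π j a := by simp [luPred]
    simpa only [Finset.union_singleton] using hsub j _ _ hsubset a hnot

theorem luPayoff_le_bound {n m : ℕ} (v : Fin m → Finset (Fin n) → ℝ)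
    (hzero : ∀ j, v j ∅ = 0)
    (hmono : ∀ j (I J : Finset (Fin n)), I ⊆ J → v j I ≤ v j J)
    {W : ℝ} (hW0 : 0 ≤ W) (hW : ∀ (j : Fin m) (Q : Finset (Fin n)), v j Q ≤ W)
    (s : Fin n → Option (Fin m)) (π : Fin n → ℕ) (i : Fin n) :
    luPayoff v s π i ≤ W := by
  unfold luPayoff
  cases s i with
  | none => exact hW0
  | some j =>
    have hnonneg := hmono j ∅ (luPred s π j i) (Finset.empty_subset _)
    rw [hzero] at hnonneg
    have hbound := hW j (luPred s π j i ∪ {i})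
    dsimp only
    linarith

/-- **fast convergence of the α-Nash dynamic.** Let `α > 0`,
`W ≥ 1` bound all party values, and let `(s^0,π^0),…,(s^T,π^T)` be a sequence
of states in which every player starts affiliated with payoff at least 1 and
every step is an α-improvement single move of some player. Then
`T ≤ n·ln(W)/ln(1+α)`. -/
theorem laborUnion_alpha_dynamic_length {n m : ℕ}
    (v : Fin m → Finset (Fin n) → ℝ)
    (hzero : ∀ j, v j ∅ = 0)
    (hmono : ∀ j (I J : Finset (Fin n)), I ⊆ J → v j I ≤ v j J)
    (hsub : ∀ j (I J : Finset (Fin n)), I ⊆ J → ∀ i ∉ J,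
      v j (insert i I) - v j I ≥ v j (insert i J) - v j J)
    (α W : ℝ) (hα : 0 < α) (hW1 : 1 ≤ W)
    (hW : ∀ (j : Fin m) (Q : Finset (Fin n)), v j Q ≤ W)
    (T : ℕ)
    (sseq : ℕ → Fin n → Option (Fin m)) (πseq : ℕ → Fin n → ℕ)
    (hinj : Function.Injective (πseq 0))
    (hstart : ∀ i : Fin n, (∃ j : Fin m, sseq 0 i = some j) ∧
      1 ≤ luPayoff v (sseq 0) (πseq 0) i)
    (hstep : ∀ k < T, ∃ (i : Fin n) (k' : Option (Fin m)),
      LUMove i k' (sseq k) (πseq k) (sseq (k + 1)) (πseq (k + 1)) ∧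
      luPayoff v (sseq (k + 1)) (πseq (k + 1)) i
        > (1 + α) * luPayoff v (sseq k) (πseq k) i) :
    (T : ℝ) ≤ n * Real.log W / Real.log (1 + α) := by
  have hlog : 0 < Real.log (1 + α) := Real.log_pos (by linarith)
  have key : ∀ k ≤ T, (∀ i, 1 ≤ luPayoff v (sseq k) (πseq k) i) ∧
      (k : ℝ) * Real.log (1 + α) ≤ ∑ i, Real.log (luPayoff v (sseq k) (πseq k) i) := by
    intro k
    induction k with
    | zero =>
      intro _
      refine ⟨fun i => (hstart i).2, ?_⟩
      simpa using Finset.sum_nonneg fun i _ => Real.log_nonneg (hstart i).2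
    | succ k ih =>
      intro hk
      obtain ⟨hone, hpot⟩ := ih (by omega)
      obtain ⟨i, k', hmove, himp⟩ := hstep k (by omega)
      have hother : ∀ a, a ≠ i → luPayoff v (sseq k) (πseq k) a
          ≤ luPayoff v (sseq (k + 1)) (πseq (k + 1)) a :=
        fun a ha => luPayoff_le_of_move v hsub hmove ha
      refine ⟨fun a => ?_, ?_⟩
      · by_cases ha : a = i
        · subst ha
          nlinarith [hone a]
        · exact (hone a).trans (hother a ha)
      · have hi : Real.log (1 + α) + Real.log (luPayoff v (sseq k) (πseq k) i)
            ≤ Real.log (luPayoff v (sseq (k + 1)) (πseq (k + 1)) i) := by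
          have hpos : 0 < luPayoff v (sseq k) (πseq k) i := by linarith [hone i]
          rw [← Real.log_mul (by positivity) hpos.ne']
          exact Real.log_le_log (by positivity) himp.le
        have hrest : ∑ a ∈ Finset.univ.erase i, Real.log (luPayoff v (sseq k) (πseq k) a)
            ≤ ∑ a ∈ Finset.univ.erase i,
              Real.log (luPayoff v (sseq (k + 1)) (πseq (k + 1)) a) :=
          Finset.sum_le_sum fun a ha =>
            Real.log_le_log (by linarith [hone a]) (hother a (Finset.ne_of_mem_erase ha))
        rw [← Finset.add_sum_erase _ _ (Finset.mem_univ i)] at hpot ⊢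
        push_cast
        linarith
  obtain ⟨hone, hpot⟩ := key T le_rfl
  rw [le_div_iff₀ hlog]
  refine hpot.trans ?_
  calc ∑ i, Real.log (luPayoff v (sseq T) (πseq T) i) ≤ ∑ _i : Fin n, Real.log W :=
        Finset.sum_le_sum fun i _ => Real.log_le_log (by linarith [hone i])
          (luPayoff_le_bound v hzero hmono (by linarith) hW _ _ i)
    _ = n * Real.log W := by simp
end

section
/- In a Labor Union game, consider any sequence of best-response improvement moves starting from the state in which every player is unaffiliated: (s^0,π^0) has s^0(i) = ⊥ for all i, and for each k, (s^{k+1},π^{k+1}) is obtained from (s^k,π^k) by a single move of some player i_k to a party j ∈ M such that u_{i_k}(s^{k+1},π^{k+1}) > u_{i_k}(s^k,π^k) and this move yields i_k at least as large a payoff as any other single move available to him at (s^k,π^k). Then after a player has made a move, at no later state of the sequence does he have a single move that strictly increases his payoff; consequently each player moves at most once and the sequence contains at most n moves, after which a Nash equilibrium is reached. -/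
/-- The payoff player `i` obtains by moving to target `k` from a state with affiliations `s`. -/
def luDeviation {n m : ℕ} (v : Fin m → Finset (Fin n) → ℝ)
    (s : Fin n → Option (Fin m)) (i : Fin n) : Option (Fin m) → ℝ
  | none => 0
  | some j => v j (insert i ((luP s j).erase i)) - v j ((luP s j).erase i)

theorem luPayoff_of_none {n m : ℕ} (v : Fin m → Finset (Fin n) → ℝ)
    {s : Fin n → Option (Fin m)} (π : Fin n → ℕ) {i : Fin n} (h : s i = none) :
    luPayoff v s π i = 0 := by
  simp [luPayoff, h]

theorem luPayoff_of_some {n m : ℕ} (v : Fin m → Finset (Fin n) → ℝ)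
    {s : Fin n → Option (Fin m)} (π : Fin n → ℕ) {i : Fin n} {j : Fin m} (h : s i = some j) :
    luPayoff v s π i = v j (luPred s π j i ∪ {i}) - v j (luPred s π j i) := by
  simp [luPayoff, h]

theorem LUMove.luPayoff_eq {n m : ℕ} (v : Fin m → Finset (Fin n) → ℝ)
    {i : Fin n} {k : Option (Fin m)} {s s' : Fin n → Option (Fin m)} {π π' : Fin n → ℕ}
    (h : LUMove i k s π s' π') : luPayoff v s' π' i = luDeviation v s i k := by
  obtain ⟨hi, hne, hlast⟩ := h
  cases k with
  | none => exact luPayoff_of_none v π' hi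
  | some j =>
    have hpred : luPred s' π' j i = (luP s j).erase i := by
      ext x
      simp only [luPred, luP, Finset.mem_filter, Finset.mem_univ, true_and, Finset.mem_erase]
      by_cases hx : x = i
      · simp [hx]
      · simp [hx, hne x hx, hlast x hx]
    rw [luPayoff_of_some v π' hi, hpred, Finset.union_singleton, luDeviation]

theorem exists_luMove {n m : ℕ} (i : Fin n) (k : Option (Fin m))
    (s : Fin n → Option (Fin m)) (π : Fin n → ℕ) :
    ∃ s' π', LUMove i k s π s' π' := by
  refine ⟨Function.update s i k, Function.update π i (Finset.univ.sup π + 1), by simp,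
    fun x hx => by simp [hx], fun x _ => ?_⟩
  simpa using Nat.lt_succ_of_le (Finset.le_sup (f := π) (Finset.mem_univ x))

/-- Deviations become no more profitable when the other players only join parties. -/
theorem luDeviation_anti {n m : ℕ} {v : Fin m → Finset (Fin n) → ℝ}
    (hsub : ∀ j (I J : Finset (Fin n)), I ⊆ J → ∀ i ∉ J,
      v j (insert i I) - v j I ≥ v j (insert i J) - v j J)
    {s s' : Fin n → Option (Fin m)} {i : Fin n}
    (h : ∀ x, x ≠ i → s x ≠ none → s' x = s x) (k : Option (Fin m)) :
    luDeviation v s' i k ≤ luDeviation v s i k := by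
  cases k with
  | none => exact le_rfl
  | some j =>
    refine hsub j _ _ (fun x hx => ?_) i (Finset.notMem_erase _ _)
    simp only [luP, Finset.mem_erase, Finset.mem_filter, Finset.mem_univ, true_and] at hx ⊢
    exact ⟨hx.1, by rw [h x hx.1 (by simp [hx.2]), hx.2]⟩

/-- A move by an unaffiliated player does not affect the payoff of the others. -/
theorem LUMove.luPayoff_eq_of_ne {n m : ℕ} (v : Fin m → Finset (Fin n) → ℝ)
    {a i : Fin n} {k : Option (Fin m)} {s s' : Fin n → Option (Fin m)} {π π' : Fin n → ℕ}
    (h : LUMove a k s π s' π') (ha : s a = none) (hi : i ≠ a) :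
    luPayoff v s' π' i = luPayoff v s π i := by
  obtain ⟨-, hne, hlast⟩ := h
  have hpred (j : Fin m) : luPred s' π' j i = luPred s π j i := by
    ext x
    simp only [luPred, Finset.mem_filter, Finset.mem_univ, true_and]
    by_cases hx : x = a
    · subst hx
      simp [ha, hne i hi, (hlast i hi).le]
    · simp [hne x hx, hne i hi]
  simp only [luPayoff, (hne i hi).1, hpred]

/-- Along best-response improvement moves from the unaffiliated state, affiliated players
have no profitable deviation. -/
theorem luDeviation_le_luPayoff_of_bestResponse {n m : ℕ} {v : Fin m → Finset (Fin n) → ℝ}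
    (hsub : ∀ j (I J : Finset (Fin n)), I ⊆ J → ∀ i ∉ J,
      v j (insert i I) - v j I ≥ v j (insert i J) - v j J)
    {T : ℕ} {sseq : ℕ → Fin n → Option (Fin m)} {πseq : ℕ → Fin n → ℕ}
    {mv : ℕ → Fin n} {tg : ℕ → Fin m}
    (h0 : ∀ i : Fin n, sseq 0 i = none)
    (hstep : ∀ k < T,
      LUMove (mv k) (some (tg k)) (sseq k) (πseq k) (sseq (k + 1)) (πseq (k + 1)) ∧
      luPayoff v (sseq (k + 1)) (πseq (k + 1)) (mv k)
        > luPayoff v (sseq k) (πseq k) (mv k) ∧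
      (∀ (k' : Option (Fin m)) (s'' : Fin n → Option (Fin m)) (π'' : Fin n → ℕ),
        LUMove (mv k) k' (sseq k) (πseq k) s'' π'' →
        luPayoff v s'' π'' (mv k)
          ≤ luPayoff v (sseq (k + 1)) (πseq (k + 1)) (mv k)))
    (t : ℕ) (ht : t ≤ T) (i : Fin n) (hi : sseq t i ≠ none) (k : Option (Fin m)) :
    luDeviation v (sseq t) i k ≤ luPayoff v (sseq t) (πseq t) i := by
  induction t generalizing i k with
  | zero => exact absurd (h0 i) hi
  | succ t ih =>
    obtain ⟨hmove, himp, hbest⟩ := hstep t ht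
    have hnone : sseq t (mv t) = none := by
      by_contra hne
      have := ih (Nat.le_of_succ_le ht) _ hne (some (tg t))
      rw [hmove.luPayoff_eq v] at himp
      linarith
    have hanti : luDeviation v (sseq (t + 1)) i k ≤ luDeviation v (sseq t) i k := by
      refine luDeviation_anti hsub (fun x _ hx => (hmove.2.1 x ?_).1) k
      rintro rfl
      exact hx hnone
    refine hanti.trans ?_
    by_cases hit : i = mv t
    · subst hit
      obtain ⟨s', π', h'⟩ := exists_luMove (mv t) k (sseq t) (πseq t)
      exact (h'.luPayoff_eq v).symm.trans_le (hbest k s' π' h')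
    · rw [hmove.luPayoff_eq_of_ne v hnone hit]
      exact ih (Nat.le_of_succ_le ht) i (by rwa [← (hmove.2.1 i hit).1]) k

/-- In a Labor Union game, consider a sequence of
best-response improvement moves starting from the all-unaffiliated state
(at step `k < T`, player `mv k` moves to party `tg k`, strictly improving his
payoff, and this move is at least as good for him as any other single move
available at `(s^k,π^k)`). Then after a player has made a move he never again
has a strictly improving single move; consequently each player moves at most
once, the sequence has at most `n` moves, and if all `n` players have moved
the final state is a Nash equilibrium. -/
theorem laborUnion_unaffiliated_dynamic {n m : ℕ}
    (v : Fin m → Finset (Fin n) → ℝ)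
    (hzero : ∀ j, v j ∅ = 0)
    (hmono : ∀ j (I J : Finset (Fin n)), I ⊆ J → v j I ≤ v j J)
    (hsub : ∀ j (I J : Finset (Fin n)), I ⊆ J → ∀ i ∉ J,
      v j (insert i I) - v j I ≥ v j (insert i J) - v j J)
    (T : ℕ)
    (sseq : ℕ → Fin n → Option (Fin m)) (πseq : ℕ → Fin n → ℕ)
    (mv : ℕ → Fin n) (tg : ℕ → Fin m)
    (h0 : ∀ i : Fin n, sseq 0 i = none)
    (hinj : Function.Injective (πseq 0))
    (hstep : ∀ k < T,
      LUMove (mv k) (some (tg k)) (sseq k) (πseq k) (sseq (k + 1)) (πseq (k + 1)) ∧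
      luPayoff v (sseq (k + 1)) (πseq (k + 1)) (mv k)
        > luPayoff v (sseq k) (πseq k) (mv k) ∧
      (∀ (k' : Option (Fin m)) (s'' : Fin n → Option (Fin m)) (π'' : Fin n → ℕ),
        LUMove (mv k) k' (sseq k) (πseq k) s'' π'' →
        luPayoff v s'' π'' (mv k)
          ≤ luPayoff v (sseq (k + 1)) (πseq (k + 1)) (mv k))) :
    -- after a player has moved, at no later state does he have a strictly
    -- improving single move
    (∀ k < T, ∀ t, k < t → t ≤ T →
      ∀ (k' : Option (Fin m)) (s'' : Fin n → Option (Fin m)) (π'' : Fin n → ℕ),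
        LUMove (mv k) k' (sseq t) (πseq t) s'' π'' →
        luPayoff v s'' π'' (mv k) ≤ luPayoff v (sseq t) (πseq t) (mv k)) ∧
    -- each player moves at most once
    (∀ k k', k < T → k' < T → mv k = mv k' → k = k') ∧
    -- hence the sequence contains at most n moves
    T ≤ n ∧
    -- and after n moves a Nash equilibrium is reached
    (T = n → ∀ (i : Fin n) (k' : Option (Fin m))
      (s'' : Fin n → Option (Fin m)) (π'' : Fin n → ℕ),
      LUMove i k' (sseq T) (πseq T) s'' π'' →
      luPayoff v s'' π'' i ≤ luPayoff v (sseq T) (πseq T) i) := by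
  have haff : ∀ k < T, ∀ t, k < t → t ≤ T → sseq t (mv k) ≠ none := by
    intro k hk t hkt
    induction t, hkt using Nat.le_induction with
    | base => simp [(hstep k hk).1.1]
    | succ t _ ih =>
      intro ht
      have hmove := (hstep t ht).1
      by_cases hkt' : mv k = mv t
      · simp [hkt', hmove.1]
      · rw [(hmove.2.1 _ hkt').1]
        exact ih (Nat.le_of_succ_le ht)
  have hstable : ∀ k < T, ∀ t, k < t → t ≤ T →
      ∀ (k' : Option (Fin m)) (s'' : Fin n → Option (Fin m)) (π'' : Fin n → ℕ),
        LUMove (mv k) k' (sseq t) (πseq t) s'' π'' →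
        luPayoff v s'' π'' (mv k) ≤ luPayoff v (sseq t) (πseq t) (mv k) := by
    intro k hk t hkt ht k' s'' π'' h
    rw [h.luPayoff_eq v]
    exact luDeviation_le_luPayoff_of_bestResponse hsub h0 hstep t ht _ (haff k hk t hkt ht) k'
  have hne : ∀ k k', k < k' → k' < T → mv k ≠ mv k' := by
    intro k k' hkk' hk' heq
    obtain ⟨hmove, himp, -⟩ := hstep k' hk'
    rw [← heq] at hmove himp
    exact himp.not_ge (hstable k (hkk'.trans hk') k' hkk' hk'.le _ _ _ hmove)
  have honce : ∀ k k', k < T → k' < T → mv k = mv k' → k = k' := by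
    intro k k' hk hk' heq
    rcases lt_trichotomy k k' with h | h | h
    · exact absurd heq (hne k k' h hk')
    · exact h
    · exact absurd heq.symm (hne k' k h hk)
  have hmv : Function.Injective fun k : Fin T => mv k :=
    fun k k' h => Fin.ext (honce k k' k.2 k'.2 h)
  refine ⟨hstable, honce, by simpa using Fintype.card_le_of_injective _ hmv, ?_⟩
  rintro rfl i k' s'' π'' h
  obtain ⟨k, rfl⟩ := Finite.surjective_of_injective hmv i
  exact hstable k k.2 T k.2 le_rfl k' s'' π'' h
end

section
/- Every Shapley game is an exact potential game with potential function Φ(S) = Σ_{j∈M} Σ_{∅ ≠ Q ⊆ Q_j(S)} ( (|Q|−1)!·(|Q_j(S)|−|Q|)! / |Q_j(S)|! ) · v_j(Q): for every state S : N → M, every player i and every party k ∈ M, it holds that Φ(S_{-i}, k) − Φ(S) = u_i(S_{-i}, k) − u_i(S). -/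
/-- Shapley payoff: player `i`'s Shapley value within his party,
`u_i(S) = ∑_{Q ⊆ Q_j(S)\{i}} (|Q|!·(|Q_j|−|Q|−1)!/|Q_j|!)·(v_j(Q ∪ {i}) − v_j(Q))`
where `j = S i`. -/
noncomputable def shapPayoff {n m : ℕ} (v : Fin m → Finset (Fin n) → ℝ)
    (S : Fin n → Fin m) (i : Fin n) : ℝ :=
  ∑ Q ∈ (Qset S (S i) \ {i}).powerset,
    ((Q.card.factorial * ((Qset S (S i)).card - Q.card - 1).factorial : ℕ) : ℝ)
      / ((Qset S (S i)).card.factorial : ℝ)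
      * (v (S i) (Q ∪ {i}) - v (S i) Q)

/-- The Shapley potential
`Φ(S) = ∑_{j∈M} ∑_{∅ ≠ Q ⊆ Q_j(S)} ((|Q|−1)!·(|Q_j|−|Q|)!/|Q_j|!)·v_j(Q)`. -/
noncomputable def shapPotential {n m : ℕ} (v : Fin m → Finset (Fin n) → ℝ)
    (S : Fin n → Fin m) : ℝ :=
  ∑ j, ∑ Q ∈ (Qset S j).powerset.erase ∅,
    (((Q.card - 1).factorial * ((Qset S j).card - Q.card).factorial : ℕ) : ℝ)
      / ((Qset S j).card.factorial : ℝ) * v j Q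

/-- The Shapley potential of a single coalition `A` for the set function `w`. -/
noncomputable def coalitionPotential {α : Type*} [DecidableEq α] (w : Finset α → ℝ)
    (A : Finset α) : ℝ :=
  ∑ Q ∈ A.powerset.erase ∅,
    (((Q.card - 1).factorial * (A.card - Q.card).factorial : ℕ) : ℝ)
      / (A.card.factorial : ℝ) * w Q

/-- Weighted marginal contributions: the difference of consecutive potential weights. -/
theorem shapley_weight_sub {a q : ℕ} (hq : 0 < q) (hqa : q ≤ a) :
    (((q - 1).factorial * (a + 1 - q).factorial : ℕ) : ℝ) / ((a + 1).factorial : ℝ)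
      - (((q - 1).factorial * (a - q).factorial : ℕ) : ℝ) / (a.factorial : ℝ)
      = -(((q.factorial * (a - q).factorial : ℕ) : ℝ) / ((a + 1).factorial : ℝ)) := by
  obtain ⟨p, rfl⟩ : ∃ p, q = p + 1 := ⟨q - 1, by omega⟩
  obtain ⟨r, rfl⟩ : ∃ r, a = p + 1 + r := ⟨a - (p + 1), by omega⟩
  have h₁ : p + 1 + r + 1 - (p + 1) = r + 1 := by omega
  have h₂ : p + 1 + r - (p + 1) = r := by omega
  have h₃ : ((p + 1 + r).factorial : ℝ) ≠ 0 := by exact_mod_cast Nat.factorial_ne_zero _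
  have h₄ : (p : ℝ) + 1 + r + 1 ≠ 0 := by positivity
  rw [h₁, h₂, Nat.add_sub_cancel, Nat.factorial_succ (p + 1 + r), Nat.factorial_succ r,
    Nat.factorial_succ p]
  push_cast
  field_simp
  ring

/-- The potential gained when `i` joins the coalition `A` is the Shapley value of `i`. -/
theorem coalitionPotential_insert_sub {α : Type*} [DecidableEq α] {w : Finset α → ℝ}
    (hw : w ∅ = 0) {A : Finset α} {i : α} (hi : i ∉ A) :
    coalitionPotential w (insert i A) - coalitionPotential w A
      = ∑ Q ∈ A.powerset, ((Q.card.factorial * (A.card - Q.card).factorial : ℕ) : ℝ)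
          / ((A.card + 1).factorial : ℝ) * (w (insert i Q) - w Q) := by
  unfold coalitionPotential
  rw [Finset.sum_erase _ (by simp [hw]), Finset.sum_erase _ (by simp [hw]),
    Finset.sum_powerset_insert hi, add_sub_right_comm, ← Finset.sum_sub_distrib,
    ← Finset.sum_add_distrib, Finset.card_insert_of_notMem hi]
  refine Finset.sum_congr rfl fun Q hQ => ?_
  have hQA := Finset.mem_powerset.mp hQ
  rw [Finset.card_insert_of_notMem fun h => hi (hQA h), Nat.add_sub_cancel,
    Nat.add_sub_add_right, ← sub_mul]
  rcases Q.eq_empty_or_nonempty with rfl | hne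
  · simp [hw]
  · rw [shapley_weight_sub hne.card_pos (Finset.card_le_card hQA)]
    ring

/-- A player's payoff is the potential lost when he is removed from his party. -/
theorem shapPayoff_eq_sub {n m : ℕ} (v : Fin m → Finset (Fin n) → ℝ) (hzero : ∀ j, v j ∅ = 0)
    (S : Fin n → Fin m) (i : Fin n) :
    shapPayoff v S i = coalitionPotential (v (S i)) (Qset S (S i))
      - coalitionPotential (v (S i)) ((Qset S (S i)).erase i) := by
  have hi : i ∈ Qset S (S i) := by simp [Qset]
  have h := coalitionPotential_insert_sub (hzero (S i)) (Finset.notMem_erase i (Qset S (S i)))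
  rw [Finset.insert_erase hi, Finset.card_erase_add_one hi] at h
  rw [h, shapPayoff, Finset.sdiff_singleton_eq_erase]
  refine Finset.sum_congr rfl fun Q _ => ?_
  rw [Finset.card_erase_of_mem hi, Nat.sub_right_comm, Finset.union_comm, ← Finset.insert_eq]

/-- The potential minus the payoff of `i` is the potential of the parties without `i`. -/
theorem shapPotential_sub_shapPayoff {n m : ℕ} (v : Fin m → Finset (Fin n) → ℝ)
    (hzero : ∀ j, v j ∅ = 0) (S : Fin n → Fin m) (i : Fin n) :
    shapPotential v S - shapPayoff v S i
      = ∑ j, coalitionPotential (v j) ((Qset S j).erase i) := by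
  have h : shapPotential v S = ∑ j, coalitionPotential (v j) (Qset S j) := rfl
  rw [h, sub_eq_iff_eq_add, ← sub_eq_iff_eq_add', ← Finset.sum_sub_distrib,
    Finset.sum_eq_single_of_mem (S i) (Finset.mem_univ _), shapPayoff_eq_sub v hzero]
  intro j _ hj
  rw [Finset.erase_eq_of_notMem (by simpa [Qset] using hj.symm), sub_self]

theorem Qset_update_erase {n m : ℕ} (S : Fin n → Fin m) (i : Fin n) (k j : Fin m) :
    (Qset (Function.update S i k) j).erase i = (Qset S j).erase i := by
  ext x
  simp +contextual [Qset, Function.update_apply]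

/-- Every Shapley game is an exact potential game with the
potential `shapPotential`: for every state `S`, player `i` and party `k`,
`Φ(S_{-i}, k) − Φ(S) = u_i(S_{-i}, k) − u_i(S)`. -/
theorem shapley_exact_potential {n m : ℕ}
    (v : Fin m → Finset (Fin n) → ℝ)
    (hzero : ∀ j, v j ∅ = 0)
    (hmono : ∀ j (I J : Finset (Fin n)), I ⊆ J → v j I ≤ v j J)
    (hsub : ∀ j (I J : Finset (Fin n)), I ⊆ J → ∀ i ∉ J,
      v j (insert i I) - v j I ≥ v j (insert i J) - v j J)
    (S : Fin n → Fin m) (i : Fin n) (k : Fin m) :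
    shapPotential v (Function.update S i k) - shapPotential v S
      = shapPayoff v (Function.update S i k) i - shapPayoff v S i := by
  have h₁ := shapPotential_sub_shapPayoff v hzero (Function.update S i k) i
  have h₂ := shapPotential_sub_shapPayoff v hzero S i
  simp only [Qset_update_erase] at h₁
  linarith
end

section
/- In every Shapley game with n ≥ 1 players, the price of anarchy with respect to the total profit is at most 2 − 1/n: if a state S : N → M is a Nash equilibrium, i.e., u_i(S) ≥ u_i(S_{-i}, k) for every player i and every party k ∈ M, then tp(S') ≤ (2 − 1/n)·tp(S) for every state S' : N → M. -/
/-- The probability that, in a uniformly random order of `a` players, a given player is preceded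
by exactly a given set of `q` players. -/
noncomputable def shapleyWeight (a q : ℕ) : ℝ :=
  ((q.factorial * (a - q - 1).factorial : ℕ) : ℝ) / (a.factorial : ℝ)

/-- The Shapley value of player `i` in the coalition `A` with respect to the set function `f`. -/
noncomputable def shapleyValue {α : Type*} [DecidableEq α] (f : Finset α → ℝ) (A : Finset α)
    (i : α) : ℝ :=
  ∑ Q ∈ (A \ {i}).powerset, shapleyWeight A.card Q.card * (f (Q ∪ {i}) - f Q)

theorem shapleyWeight_nonneg (a q : ℕ) : 0 ≤ shapleyWeight a q := by
  unfold shapleyWeight; positivity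

theorem shapleyWeight_zero {a : ℕ} (ha : 0 < a) : shapleyWeight a 0 = 1 / a := by
  obtain ⟨b, rfl⟩ := Nat.exists_eq_add_of_lt ha
  simp only [zero_add, shapleyWeight, Nat.factorial_zero, Nat.factorial_succ, one_mul,
    Nat.sub_zero, Nat.add_sub_cancel]
  have := Nat.factorial_ne_zero b
  push_cast
  field_simp

theorem mul_shapleyWeight_pred {a t : ℕ} (ht : 0 < t) (hta : t < a) :
    (t : ℝ) * shapleyWeight a (t - 1) = ((a - t : ℕ) : ℝ) * shapleyWeight a t := by
  obtain ⟨s, rfl⟩ := Nat.exists_eq_add_of_lt ht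
  obtain ⟨r, rfl⟩ := Nat.exists_eq_add_of_lt hta
  have h₁ : 0 + s + 1 + r + 1 - (0 + s + 1 - 1) - 1 = r + 1 := by omega
  have h₃ : 0 + s + 1 + r + 1 - (0 + s + 1) = r + 1 := by omega
  have h₄ : 0 + s + 1 - 1 = s := by omega
  have h₅ : 0 + s + 1 = s + 1 := by omega
  simp only [shapleyWeight, h₁, h₃]
  rw [h₄, h₅, Nat.factorial_succ s, Nat.factorial_succ r]
  push_cast
  ring

theorem mul_shapleyWeight_self {a : ℕ} (ha : 0 < a) : (a : ℝ) * shapleyWeight a (a - 1) = 1 := by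
  obtain ⟨b, rfl⟩ := Nat.exists_eq_add_of_lt ha
  have h : 0 + b + 1 - (0 + b + 1 - 1) - 1 = 0 := by omega
  simp only [shapleyWeight, h]
  have := Nat.factorial_ne_zero b
  simp only [zero_add, Nat.add_sub_cancel, Nat.factorial_succ, Nat.factorial_zero]
  push_cast
  field_simp

section

variable {α : Type*} [DecidableEq α]

/-- The Shapley values in a coalition add up to the worth of the coalition. -/
theorem sum_shapleyValue {f : Finset α → ℝ} (h₀ : f ∅ = 0) (A : Finset α) :
    ∑ i ∈ A, shapleyValue f A i = f A := by
  have hin : ∑ i ∈ A, ∑ Q ∈ (A \ {i}).powerset, shapleyWeight A.card Q.card * f (Q ∪ {i})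
      = ∑ T ∈ A.powerset, (T.card : ℝ) * shapleyWeight A.card (T.card - 1) * f T := by
    have h : ∀ i ∈ A,
        ∑ Q ∈ (A \ {i}).powerset, shapleyWeight A.card Q.card * f (Q ∪ {i})
          = ∑ T ∈ A.powerset with i ∈ T, shapleyWeight A.card (T.card - 1) * f T := by
      intro i hi
      refine Finset.sum_nbij' (fun Q => Q ∪ {i}) (fun T => T \ {i}) ?_ ?_ ?_ ?_ ?_
      · intro Q hQ
        simp only [Finset.mem_powerset, Finset.mem_filter, Finset.subset_iff] at hQ ⊢
        grind
      · intro T hT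
        simp only [Finset.mem_powerset, Finset.mem_filter, Finset.subset_iff] at hT ⊢
        grind
      · intro Q hQ
        simp only [Finset.mem_powerset, Finset.subset_iff] at hQ
        grind
      · intro T hT
        grind
      · intro Q hQ
        have hiQ : i ∉ Q := fun h => by
          simpa using Finset.mem_powerset.1 hQ h
        have : (Q ∪ {i}).card = Q.card + 1 := by
          rw [Finset.union_comm, ← Finset.insert_eq, Finset.card_insert_of_notMem hiQ]
        rw [this, Nat.add_sub_cancel]
    rw [Finset.sum_congr rfl h,
      Finset.sum_comm' (t' := A.powerset) (s' := fun T => T)]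
    · exact Finset.sum_congr rfl fun T _ => by
        rw [Finset.sum_const, nsmul_eq_mul, mul_assoc]
    · intro i T
      simp only [Finset.mem_powerset, Finset.mem_filter, Finset.subset_iff]
      grind
  have hout : ∑ i ∈ A, ∑ Q ∈ (A \ {i}).powerset, shapleyWeight A.card Q.card * f Q
      = ∑ T ∈ A.powerset, ((A.card - T.card : ℕ) : ℝ) * shapleyWeight A.card T.card * f T := by
    rw [Finset.sum_comm' (t' := A.powerset) (s' := fun T => A \ T)]
    · refine Finset.sum_congr rfl fun T hT => ?_
      rw [Finset.sum_const, nsmul_eq_mul, mul_assoc,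
        Finset.card_sdiff_of_subset (Finset.mem_powerset.1 hT)]
    · intro i T
      simp only [Finset.mem_powerset, Finset.mem_sdiff, Finset.subset_iff]
      grind
  simp only [shapleyValue, mul_sub, Finset.sum_sub_distrib]
  rw [hin, hout, ← Finset.sum_sub_distrib,
    Finset.sum_eq_single_of_mem A (Finset.mem_powerset_self A)]
  · rcases A.eq_empty_or_nonempty with rfl | hA
    · simp [h₀]
    · simp [mul_shapleyWeight_self hA.card_pos]
  · intro T hT hne
    rcases T.eq_empty_or_nonempty with rfl | hT'
    · simp [h₀]
    · have hlt := Finset.card_lt_card ((Finset.mem_powerset.1 hT).ssubset_of_ne hne)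
      rw [mul_shapleyWeight_pred hT'.card_pos hlt, sub_self]

theorem sum_shapleyWeight {A : Finset α} {i : α} (hi : i ∈ A) :
    ∑ Q ∈ (A \ {i}).powerset, shapleyWeight A.card Q.card = 1 := by
  -- Efficiency for the dictator game of player `i`.
  have h := sum_shapleyValue (f := fun T => if i ∈ T then (1 : ℝ) else 0) (by simp) A
  rw [Finset.sum_eq_single_of_mem i hi, if_pos hi] at h
  · rw [← h]
    refine Finset.sum_congr rfl fun Q hQ => ?_
    have hiQ : i ∉ Q := fun h => by simpa using Finset.mem_powerset.1 hQ h
    simp [hiQ]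
  · intro k _ hk
    refine Finset.sum_eq_zero fun Q _ => ?_
    simp [hk.symm]

/-- For a submodular set function, the sum of the marginal contributions of the members of `B` to
`A` is at least the marginal contribution of `B`. -/
theorem sub_le_sum_marginal {f : Finset α → ℝ}
    (hsub : ∀ I J : Finset α, I ⊆ J → ∀ i ∉ J, f (insert i I) - f I ≥ f (insert i J) - f J)
    (hmono : ∀ I J : Finset α, I ⊆ J → f I ≤ f J) (A B : Finset α) :
    f (A ∪ B) - f A ≤ ∑ i ∈ B, (f (insert i A) - f A) := by
  induction B using Finset.induction_on with
  | empty => simp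
  | insert b B hb ih =>
    rw [Finset.sum_insert hb, Finset.union_insert]
    by_cases h : b ∈ A ∪ B
    · have := hmono _ _ (Finset.subset_insert b A)
      rw [Finset.insert_eq_of_mem h]
      linarith
    · have := hsub A (A ∪ B) Finset.subset_union_left b h
      linarith

/-- For a submodular set function, the Shapley value of a player is at least the average of his own
worth and his marginal contribution to the others, where the former has weight `1 / |A|`. -/
theorem le_shapleyValue {f : Finset α → ℝ} (h₀ : f ∅ = 0)
    (hsub : ∀ I J : Finset α, I ⊆ J → ∀ i ∉ J, f (insert i I) - f I ≥ f (insert i J) - f J)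
    {A : Finset α} {i : α} (hi : i ∈ A) :
    1 / (A.card : ℝ) * f {i} + (1 - 1 / (A.card : ℝ)) * (f A - f (A \ {i}))
      ≤ shapleyValue f A i := by
  set d := f A - f (A \ {i}) with hd
  have hA : insert i (A \ {i}) = A := by grind
  have hterm : ∀ Q ∈ (A \ {i}).powerset,
      0 ≤ shapleyWeight A.card Q.card * (f (Q ∪ {i}) - f Q - d) := by
    intro Q hQ
    have := hsub Q (A \ {i}) (Finset.mem_powerset.1 hQ) i (by simp)
    rw [hA, Finset.insert_eq, Finset.union_comm] at this
    exact mul_nonneg (shapleyWeight_nonneg _ _) (by linarith)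
  have hsingle := Finset.single_le_sum hterm (Finset.empty_mem_powerset _)
  have hsum : ∑ Q ∈ (A \ {i}).powerset, shapleyWeight A.card Q.card * (f (Q ∪ {i}) - f Q - d)
      = shapleyValue f A i - d := by
    simp only [mul_sub _ _ d, Finset.sum_sub_distrib, ← Finset.sum_mul, sum_shapleyWeight hi,
      one_mul, shapleyValue]
  rw [hsum, Finset.card_empty, shapleyWeight_zero (Finset.card_pos.2 ⟨i, hi⟩),
    Finset.empty_union, h₀] at hsingle
  linarith

/-- The smoothness inequality: the Shapley values that the members of `B` obtain by
individually joining `A` add up to at least `f B - (1 - 1 / n) * f A`. -/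
theorem le_sum_shapleyValue_insert [Fintype α] [Nonempty α] {f : Finset α → ℝ} (h₀ : f ∅ = 0)
    (hmono : ∀ I J : Finset α, I ⊆ J → f I ≤ f J)
    (hsub : ∀ I J : Finset α, I ⊆ J → ∀ i ∉ J, f (insert i I) - f I ≥ f (insert i J) - f J)
    (A B : Finset α) :
    f B - (1 - 1 / (Fintype.card α : ℝ)) * f A ≤ ∑ i ∈ B, shapleyValue f (insert i A) i := by
  set c : ℝ := 1 / (Fintype.card α : ℝ)
  have hc₀ : 0 ≤ c := by positivity
  have hc₁ : c ≤ 1 := by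
    have : (1 : ℝ) ≤ Fintype.card α := by exact_mod_cast Fintype.card_pos
    exact (div_le_one (by linarith)).2 this
  have hpoint : ∀ i ∈ B,
      c * f {i} + (1 - c) * (f (insert i A) - f A) ≤ shapleyValue f (insert i A) i := by
    intro i _
    refine le_trans ?_ (le_shapleyValue h₀ hsub (Finset.mem_insert_self i A))
    set a : ℝ := 1 / ((insert i A).card : ℝ)
    have hpos : 0 < (insert i A).card := Finset.card_pos.2 ⟨i, Finset.mem_insert_self i A⟩
    have hca : c ≤ a := one_div_le_one_div_of_le (by exact_mod_cast hpos)
      (by exact_mod_cast Finset.card_le_univ (insert i A))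
    have ha₁ : a ≤ 1 := by
      have : (1 : ℝ) ≤ (insert i A).card := by exact_mod_cast hpos
      exact (div_le_one (by linarith)).2 this
    have hle : f (insert i A) - f A ≤ f (insert i A) - f (insert i A \ {i}) := by
      have := hmono (insert i A \ {i}) A (by grind)
      linarith
    have hle' : f (insert i A) - f A ≤ f {i} := by
      by_cases hiA : i ∈ A
      · have := hmono ∅ {i} (Finset.empty_subset _)
        rw [Finset.insert_eq_of_mem hiA]
        linarith
      · have := hsub ∅ A (Finset.empty_subset _) i hiA
        rw [insert_empty_eq, h₀] at this
        linarith
    nlinarith [mul_nonneg (sub_nonneg.2 hca) (sub_nonneg.2 hle'),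
      mul_nonneg (sub_nonneg.2 ha₁) (sub_nonneg.2 hle)]
  refine le_trans ?_ (Finset.sum_le_sum hpoint)
  rw [Finset.sum_add_distrib, ← Finset.mul_sum, ← Finset.mul_sum]
  have hB : f B ≤ ∑ i ∈ B, f {i} := by
    simpa [h₀] using sub_le_sum_marginal hsub hmono ∅ B
  have hAB := sub_le_sum_marginal hsub hmono A B
  have hBA := hmono B (A ∪ B) Finset.subset_union_right
  nlinarith [mul_le_mul_of_nonneg_left hB hc₀,
    mul_le_mul_of_nonneg_left hAB (sub_nonneg.2 hc₁),
    mul_le_mul_of_nonneg_left hBA (sub_nonneg.2 hc₁)]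

end

theorem shapPayoff_eq_shapleyValue {n m : ℕ} (v : Fin m → Finset (Fin n) → ℝ)
    (S : Fin n → Fin m) (i : Fin n) :
    shapPayoff v S i = shapleyValue (v (S i)) (Qset S (S i)) i := rfl

theorem Qset_update_self {n m : ℕ} (S : Fin n → Fin m) (i : Fin n) (k : Fin m) :
    Qset (Function.update S i k) k = insert i (Qset S k) := by
  ext x
  by_cases hx : x = i <;> simp [Qset, Function.update_apply, hx]

theorem sum_eq_sum_sum_Qset {n m : ℕ} (S : Fin n → Fin m) (g : Fin m → Fin n → ℝ) :
    ∑ i, g (S i) i = ∑ j, ∑ i ∈ Qset S j, g j i := by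
  rw [← Finset.sum_fiberwise Finset.univ S]
  refine Finset.sum_congr rfl fun j _ => Finset.sum_congr rfl fun i hi => ?_
  rw [(Finset.mem_filter.1 hi).2]

/-- In every Shapley game with `n ≥ 1` players, the price of
anarchy with respect to the total profit is at most `2 − 1/n`: if `S` is a
Nash equilibrium then `tp(S') ≤ (2 − 1/n)·tp(S)` for every state `S'`. -/
theorem shapley_poa {n m : ℕ} (hn : 1 ≤ n)
    (v : Fin m → Finset (Fin n) → ℝ)
    (hzero : ∀ j, v j ∅ = 0)
    (hmono : ∀ j (I J : Finset (Fin n)), I ⊆ J → v j I ≤ v j J)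
    (hsub : ∀ j (I J : Finset (Fin n)), I ⊆ J → ∀ i ∉ J,
      v j (insert i I) - v j I ≥ v j (insert i J) - v j J)
    (S : Fin n → Fin m)
    (hNE : ∀ (i : Fin n) (k : Fin m),
      shapPayoff v S i ≥ shapPayoff v (Function.update S i k) i) :
    ∀ S' : Fin n → Fin m,
      totalProfit v S' ≤ (2 - 1 / (n : ℝ)) * totalProfit v S := by
  intro S'
  have : Nonempty (Fin n) := ⟨⟨0, hn⟩⟩
  have heff : ∑ i, shapPayoff v S i = totalProfit v S := by
    simp only [shapPayoff_eq_shapleyValue]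
    rw [sum_eq_sum_sum_Qset S fun j i => shapleyValue (v j) (Qset S j) i]
    exact Finset.sum_congr rfl fun j _ => sum_shapleyValue (hzero j) _
  have hdev : ∑ i, shapleyValue (v (S' i)) (insert i (Qset S (S' i))) i
      ≤ ∑ i, shapPayoff v S i := by
    refine Finset.sum_le_sum fun i _ => ?_
    have h := hNE i (S' i)
    rwa [shapPayoff_eq_shapleyValue v (Function.update S i (S' i)), Function.update_self,
      Qset_update_self] at h
  rw [heff, sum_eq_sum_sum_Qset S' fun j i => shapleyValue (v j) (insert i (Qset S j)) i] at hdev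
  have hsmooth := Finset.sum_le_sum fun j (_ : j ∈ Finset.univ) =>
    le_sum_shapleyValue_insert (hzero j) (hmono j) (hsub j) (Qset S j) (Qset S' j)
  rw [Finset.sum_sub_distrib, ← Finset.mul_sum, Fintype.card_fin] at hsmooth
  change totalProfit v S' - (1 - 1 / (n : ℝ)) * totalProfit v S ≤ _ at hsmooth
  linarith
end

section
/- For every n ≥ 3 there exists a Shapley game with n players and m = 2 parties, i.e., functions v_1, v_2 : 2^N → ℝ with v_j(∅) = 0, non-decreasing and submodular, such that: (a) max_{S : N → {1,2}} tp(S) = 2; (b) there is a Nash equilibrium S with tp(S) = 1 + 1/n, and every Nash equilibrium S' satisfies tp(S') ≥ 1 + 1/n; and (c) there is a Nash equilibrium S with tp(S) = 1 + 2/(n−1), and every Nash equilibrium S' satisfies tp(S') ≤ 1 + 2/(n−1). Consequently, the price of anarchy of this game equals 2 − 2/(n+1) and its price of stability equals 2 − 4/(n+1). -/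
/-- `S` is a Nash equilibrium of the Shapley game given by `v`. -/
noncomputable def ShapNE {n m : ℕ} (v : Fin m → Finset (Fin n) → ℝ)
    (S : Fin n → Fin m) : Prop :=
  ∀ (i : Fin n) (k : Fin m), shapPayoff v S i ≥ shapPayoff v (Function.update S i k) i

open Finset in
/-- The Shapley weights of the coalitions not containing a given player sum to one. -/
theorem sum_shapley_weight {α : Type*} [DecidableEq α] (A : Finset α) {i : α} (hi : i ∈ A) :
    ∑ Q ∈ (A \ {i}).powerset,
      ((Q.card.factorial * (A.card - Q.card - 1).factorial : ℕ) : ℝ)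
        / (A.card.factorial : ℝ) = 1 := by
  obtain ⟨a, ha⟩ : ∃ a, A.card = a + 1 :=
    ⟨A.card - 1, (Nat.succ_pred_eq_of_pos (card_pos.mpr ⟨i, hi⟩)).symm⟩
  have hcard : (A \ {i}).card = a := by
    rw [card_sdiff_of_subset (by simpa using hi), card_singleton, ha]; rfl
  rw [sum_powerset_apply_card
    (fun k => ((k.factorial * (A.card - k - 1).factorial : ℕ) : ℝ) / (A.card.factorial : ℝ)),
    hcard, ha]
  have hterm : ∀ k ∈ range (a + 1), a.choose k •
      (((k.factorial * (a + 1 - k - 1).factorial : ℕ) : ℝ) / ((a + 1).factorial : ℝ))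
        = 1 / ((a : ℝ) + 1) := by
    intro k hk
    have hk' : k ≤ a := Nat.lt_succ_iff.mp (mem_range.mp hk)
    have h := Nat.choose_mul_factorial_mul_factorial hk'
    have hsub : a + 1 - k - 1 = a - k := by omega
    have hne : (a.factorial : ℝ) ≠ 0 := by positivity
    rw [hsub, nsmul_eq_mul, ← mul_div_assoc, ← Nat.cast_mul, ← mul_assoc, h, Nat.factorial_succ]
    push_cast
    field_simp
  rw [sum_congr rfl hterm, sum_const, card_range, nsmul_eq_mul]
  push_cast
  field_simp

theorem mem_Qset {n m : ℕ} {S : Fin n → Fin m} {j : Fin m} {i : Fin n} :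
    i ∈ Qset S j ↔ S i = j := by
  simp [Qset]

theorem card_Qset_zero_add_card_Qset_one {n : ℕ} (S : Fin n → Fin 2) :
    (Qset S 0).card + (Qset S 1).card = n := by
  have h : Qset S 1 = Finset.univ.filter fun i => ¬ S i = 0 := by
    ext i; rw [mem_Qset]; simp; omega
  rw [h, Qset, Finset.card_filter_add_card_filter_not, Finset.card_univ, Fintype.card_fin]

/-- Party `0` is worth `1` as soon as it is nonempty; party `1` is additive with weights `w`. -/
noncomputable def unitAdditive {n : ℕ} (w : Fin n → ℝ) (j : Fin 2) (Q : Finset (Fin n)) : ℝ :=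
  if j = 0 then (if Q = ∅ then 0 else 1) else ∑ i ∈ Q, w i

section unitAdditive

variable {n : ℕ} (w : Fin n → ℝ)

theorem unitAdditive_zero (Q : Finset (Fin n)) :
    unitAdditive w 0 Q = if Q = ∅ then 0 else 1 := by
  simp [unitAdditive]

theorem unitAdditive_one (Q : Finset (Fin n)) : unitAdditive w 1 Q = ∑ i ∈ Q, w i := by
  simp [unitAdditive]

theorem unitAdditive_mono (hw : ∀ i, 0 ≤ w i) (j : Fin 2) {I J : Finset (Fin n)} (h : I ⊆ J) :
    unitAdditive w j I ≤ unitAdditive w j J := by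
  unfold unitAdditive
  split_ifs with _ h₁ h₂ h₂
  · rfl
  · exact zero_le_one
  · exact absurd (Finset.subset_empty.mp (h₂ ▸ h)) h₁
  · rfl
  · exact Finset.sum_le_sum_of_subset_of_nonneg h fun i _ _ => hw i

theorem unitAdditive_submodular (j : Fin 2) {I J : Finset (Fin n)} (h : I ⊆ J) {i : Fin n}
    (hi : i ∉ J) :
    unitAdditive w j (insert i J) - unitAdditive w j J
      ≤ unitAdditive w j (insert i I) - unitAdditive w j I := by
  unfold unitAdditive
  by_cases hj : j = 0
  · simp only [if_pos hj, Finset.insert_ne_empty, if_false]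
    split_ifs with h₁ h₂ h₂
    · rfl
    · exact absurd (Finset.subset_empty.mp (h₁ ▸ h)) h₂
    · norm_num
    · rfl
  · simp only [if_neg hj, Finset.sum_insert hi, Finset.sum_insert fun hI => hi (h hI)]
    simp

theorem shapPayoff_unitAdditive_of_eq_zero {S : Fin n → Fin 2} {i : Fin n} (hi : S i = 0) :
    shapPayoff (unitAdditive w) S i = 1 / ((Qset S 0).card : ℝ) := by
  have hmem : i ∈ Qset S 0 := mem_Qset.mpr hi
  have hpos : 0 < (Qset S 0).card := Finset.card_pos.mpr ⟨i, hmem⟩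
  unfold shapPayoff
  rw [hi, Finset.sum_eq_single ∅]
  · rw [unitAdditive_zero, unitAdditive_zero, if_pos rfl, Finset.empty_union,
      if_neg (Finset.singleton_ne_empty i), Finset.card_empty, Nat.sub_zero,
      ← Nat.mul_factorial_pred hpos.ne']
    have : (((Qset S 0).card - 1).factorial : ℝ) ≠ 0 := by positivity
    push_cast
    field_simp
    simp
  · intro Q _ hQ
    have : Q ∪ {i} ≠ ∅ := fun h => hQ (Finset.union_eq_empty.mp h).1
    rw [unitAdditive_zero, unitAdditive_zero, if_neg hQ, if_neg this, sub_self, mul_zero]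
  · intro h
    exact absurd (Finset.empty_mem_powerset _) h

theorem shapPayoff_unitAdditive_of_eq_one {S : Fin n → Fin 2} {i : Fin n} (hi : S i = 1) :
    shapPayoff (unitAdditive w) S i = w i := by
  have hterm : ∀ Q ∈ (Qset S 1 \ {i}).powerset,
      unitAdditive w 1 (Q ∪ {i}) - unitAdditive w 1 Q = w i := by
    intro Q hQ
    have hQi : i ∉ Q := fun h => by simpa using Finset.mem_powerset.mp hQ h
    rw [unitAdditive_one, unitAdditive_one, Finset.union_comm, ← Finset.insert_eq,
      Finset.sum_insert hQi, add_sub_cancel_right]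
  unfold shapPayoff
  rw [hi, Finset.sum_congr rfl fun Q hQ => by rw [hterm Q hQ], ← Finset.sum_mul,
    sum_shapley_weight _ (mem_Qset.mpr hi), one_mul]

theorem shapNE_unitAdditive_iff (S : Fin n → Fin 2) :
    ShapNE (unitAdditive w) S ↔
      (∀ i, S i = 0 → w i ≤ 1 / ((Qset S 0).card : ℝ)) ∧
        ∀ i, S i = 1 → 1 / (((Qset S 0).card : ℝ) + 1) ≤ w i := by
  have hzero : ∀ i, S i = 0 → shapPayoff (unitAdditive w) (Function.update S i 1) i = w i :=
    fun i _ => shapPayoff_unitAdditive_of_eq_one w (by simp)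
  have hone : ∀ i, S i = 1 → shapPayoff (unitAdditive w) (Function.update S i 0) i
      = 1 / (((Qset S 0).card : ℝ) + 1) := by
    intro i hi
    have hmem : i ∉ Qset S 0 := by simp [mem_Qset, hi]
    rw [shapPayoff_unitAdditive_of_eq_zero w (by simp), Qset_update_self,
      Finset.card_insert_of_notMem hmem]
    push_cast
    rfl
  constructor
  · refine fun h => ⟨fun i hi => ?_, fun i hi => ?_⟩
    · have := h i 1
      rwa [ge_iff_le, hzero i hi, shapPayoff_unitAdditive_of_eq_zero w hi] at this
    · have := h i 0
      rwa [ge_iff_le, hone i hi, shapPayoff_unitAdditive_of_eq_one w hi] at this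
  · rintro ⟨h₀, h₁⟩ i k
    by_cases hk : k = S i
    · rw [hk, Function.update_eq_self]
    · obtain hi | hi : S i = 0 ∨ S i = 1 := by omega
      · obtain rfl : k = 1 := by omega
        rw [hzero i hi, shapPayoff_unitAdditive_of_eq_zero w hi]
        exact h₀ i hi
      · obtain rfl : k = 0 := by omega
        rw [hone i hi, shapPayoff_unitAdditive_of_eq_one w hi]
        exact h₁ i hi

theorem totalProfit_unitAdditive (S : Fin n → Fin 2) :
    totalProfit (unitAdditive w) S
      = (if Qset S 0 = ∅ then 0 else 1) + ∑ i ∈ Qset S 1, w i := by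
  rw [totalProfit, Fin.sum_univ_two, unitAdditive_zero, unitAdditive_one]

end unitAdditive

/-- Player `0` has weight `1 / n`, every other player has weight `1 / (n - 1)`. -/
noncomputable def lightFirstWeight (n : ℕ) (i : Fin n) : ℝ :=
  if (i : ℕ) = 0 then 1 / (n : ℝ) else 1 / ((n : ℝ) - 1)

/-- For every `n ≥ 3` there is a Shapley game with `n`
players and two parties such that (a) the optimum total profit is `2`;
(b) the worst Nash equilibrium has total profit exactly `1 + 1/n`;
(c) the best Nash equilibrium has total profit exactly `1 + 2/(n−1)`.
Consequently its price of anarchy is `2 − 2/(n+1)` and its price of stability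
is `2 − 4/(n+1)`. -/
theorem shapley_poa_pos_tight (n : ℕ) (hn : 3 ≤ n) :
    ∃ v : Fin 2 → Finset (Fin n) → ℝ,
      (∀ j, v j ∅ = 0) ∧
      (∀ j (I J : Finset (Fin n)), I ⊆ J → v j I ≤ v j J) ∧
      (∀ j (I J : Finset (Fin n)), I ⊆ J → ∀ i ∉ J,
        v j (insert i I) - v j I ≥ v j (insert i J) - v j J) ∧
      -- (a) the maximum total profit equals 2
      (∀ S : Fin n → Fin 2, totalProfit v S ≤ 2) ∧
      (∃ S : Fin n → Fin 2, totalProfit v S = 2) ∧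
      -- (b) worst Nash equilibrium: total profit 1 + 1/n
      (∃ S : Fin n → Fin 2, ShapNE v S ∧ totalProfit v S = 1 + 1 / (n : ℝ)) ∧
      (∀ S : Fin n → Fin 2, ShapNE v S → 1 + 1 / (n : ℝ) ≤ totalProfit v S) ∧
      -- (c) best Nash equilibrium: total profit 1 + 2/(n−1)
      (∃ S : Fin n → Fin 2, ShapNE v S ∧ totalProfit v S = 1 + 2 / ((n : ℝ) - 1)) ∧
      (∀ S : Fin n → Fin 2, ShapNE v S → totalProfit v S ≤ 1 + 2 / ((n : ℝ) - 1)) ∧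
      -- consequently: PoA = 2 − 2/(n+1) and PoS = 2 − 4/(n+1)
      2 / (1 + 1 / (n : ℝ)) = 2 - 2 / ((n : ℝ) + 1) ∧
      2 / (1 + 2 / ((n : ℝ) - 1)) = 2 - 4 / ((n : ℝ) + 1) := by
  have hn' : (3 : ℝ) ≤ n := by exact_mod_cast hn
  have hn0 : (0 : ℝ) < n := by linarith
  have hn1 : (0 : ℝ) < (n : ℝ) - 1 := by linarith
  have hlt : 1 / (n : ℝ) ≤ 1 / ((n : ℝ) - 1) := one_div_le_one_div_of_le hn1 (by linarith)
  set w := lightFirstWeight n with hw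
  have hw_lower : ∀ i, 1 / (n : ℝ) ≤ w i := by
    intro i; rw [hw, lightFirstWeight]; split_ifs; exacts [le_rfl, hlt]
  have hw_upper : ∀ i, w i ≤ 1 / ((n : ℝ) - 1) := by
    intro i; rw [hw, lightFirstWeight]; split_ifs; exacts [hlt, le_rfl]
  have hw_nonneg : ∀ i, 0 ≤ w i := fun i => le_trans (by positivity) (hw_lower i)
  let p : Fin n := ⟨0, by omega⟩
  let q : Fin n := ⟨1, by omega⟩
  let r : Fin n := ⟨2, by omega⟩
  have hwp : w p = 1 / (n : ℝ) := by simp [hw, lightFirstWeight, p]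
  have hw_ne : ∀ i, i ≠ p → w i = 1 / ((n : ℝ) - 1) := by
    intro i hi
    have : (i : ℕ) ≠ 0 := fun h => hi (Fin.ext h)
    simp [hw, lightFirstWeight, this]
  have hqp : q ≠ p := by simp [p, q]
  have hrp : r ≠ p := by simp [p, r]
  have hqr : q ≠ r := by simp [q, r]
  have hcard : ∀ S : Fin n → Fin 2,
      ((Qset S 0).card : ℝ) = n - (Qset S 1).card := by
    intro S
    rw [eq_sub_iff_add_eq]
    exact_mod_cast card_Qset_zero_add_card_Qset_one S
  have hsum_le : ∀ T : Finset (Fin n), ∑ i ∈ T, w i ≤ T.card * (1 / ((n : ℝ) - 1)) := by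
    intro T
    rw [← nsmul_eq_mul]
    exact Finset.sum_le_card_nsmul _ _ _ fun i _ => hw_upper i
  have htotal : ∑ i, w i = 1 + 1 / (n : ℝ) := by
    rw [← Finset.add_sum_erase _ _ (Finset.mem_univ p), hwp,
      Finset.sum_congr rfl fun i hi => hw_ne i (Finset.ne_of_mem_erase hi), Finset.sum_const,
      Finset.card_erase_of_mem (Finset.mem_univ p), Finset.card_univ, Fintype.card_fin,
      nsmul_eq_mul, Nat.cast_sub (by omega)]
    push_cast
    rw [mul_one_div_cancel hn1.ne', add_comm]
  have hne_bounds : ∀ S : Fin n → Fin 2, ShapNE (unitAdditive w) S →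
      Qset S 0 ≠ ∅ ∧ (Qset S 1).Nonempty ∧ (Qset S 1).card ≤ 2 := by
    intro S hS
    obtain ⟨h₀, h₁⟩ := (shapNE_unitAdditive_iff w S).mp hS
    refine ⟨fun h => ?_, ?_, ?_⟩
    · have hp : S p = 1 := by
        have : p ∉ Qset S 0 := by simp [h]
        rw [mem_Qset] at this; omega
      have := h₁ p hp
      rw [hwp, h, Finset.card_empty, one_div_le_one_div (by simp) hn0] at this
      push_cast at this
      linarith
    · by_contra h
      rw [Finset.not_nonempty_iff_eq_empty] at h
      have hq : S q = 0 := by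
        have : q ∉ Qset S 1 := by simp [h]
        rw [mem_Qset] at this; omega
      have := h₀ q hq
      rw [hw_ne q hqp, hcard, h, Finset.card_empty, Nat.cast_zero, sub_zero,
        one_div_le_one_div hn1 hn0] at this
      linarith
    · obtain h | ⟨i, hi⟩ := (Qset S 1).eq_empty_or_nonempty
      · simp [h]
      · have := (h₁ i (mem_Qset.mp hi)).trans (hw_upper i)
        rw [one_div_le_one_div (by positivity) hn1, hcard] at this
        have h2 : ((Qset S 1).card : ℝ) ≤ 2 := by linarith
        exact_mod_cast h2
  refine ⟨unitAdditive w, ?_, fun j I J h => unitAdditive_mono w hw_nonneg j h,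
    fun j I J h i hi => unitAdditive_submodular w j h hi, ?_, ?_, ?_, ?_, ?_, ?_, ?_, ?_⟩
  · intro j; simp [unitAdditive]
  · intro S
    rw [totalProfit_unitAdditive]
    split_ifs with h
    · have hle : ∑ i ∈ Qset S 1, w i ≤ ∑ i, w i :=
        Finset.sum_le_sum_of_subset_of_nonneg (Finset.subset_univ _) fun i _ _ => hw_nonneg i
      have : 1 / (n : ℝ) ≤ 1 := (div_le_one hn0).mpr (by linarith)
      linarith
    · obtain ⟨i, hi⟩ := Finset.nonempty_iff_ne_empty.mpr h
      have hi' : i ∉ Qset S 1 := by rw [mem_Qset] at hi ⊢; omega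
      have hle : ∑ j ∈ insert i (Qset S 1), w j ≤ ∑ j, w j :=
        Finset.sum_le_sum_of_subset_of_nonneg (Finset.subset_univ _) fun i _ _ => hw_nonneg i
      rw [Finset.sum_insert hi'] at hle
      linarith [hw_lower i]
  · refine ⟨fun i => if i = p then 0 else 1, ?_⟩
    have hQ0 : Qset (fun i => if i = p then (0 : Fin 2) else 1) 0 ≠ ∅ :=
      Finset.nonempty_iff_ne_empty.mp ⟨p, by simp [mem_Qset]⟩
    have hQ1 : Qset (fun i => if i = p then (0 : Fin 2) else 1) 1 = Finset.univ.erase p := by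
      ext i; simp [mem_Qset]
    rw [totalProfit_unitAdditive, if_neg hQ0, hQ1]
    have := Finset.add_sum_erase _ w (Finset.mem_univ p)
    linarith
  · have hQ : Qset (fun i => if i = p then (1 : Fin 2) else 0) 1 = {p} := by
      ext i; simp [mem_Qset]
    have hNE : ShapNE (unitAdditive w) fun i => if i = p then (1 : Fin 2) else 0 := by
      rw [shapNE_unitAdditive_iff, hcard, hQ, Finset.card_singleton, Nat.cast_one]
      refine ⟨fun i _ => hw_upper i, fun i _ => ?_⟩
      rw [sub_add_cancel]
      exact hw_lower i
    refine ⟨_, hNE, ?_⟩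
    rw [totalProfit_unitAdditive, if_neg (hne_bounds _ hNE).1, hQ, Finset.sum_singleton, hwp]
  · intro S hS
    obtain ⟨h₀, ⟨i, hi⟩, -⟩ := hne_bounds S hS
    rw [totalProfit_unitAdditive, if_neg h₀]
    have := Finset.single_le_sum (fun j _ => hw_nonneg j) hi
    linarith [hw_lower i]
  · have hQ : Qset (fun i => if i = q ∨ i = r then (1 : Fin 2) else 0) 1 = {q, r} := by
      ext i; simp [mem_Qset, or_iff_not_imp_left]
    have hNE : ShapNE (unitAdditive w) fun i => if i = q ∨ i = r then (1 : Fin 2) else 0 := by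
      rw [shapNE_unitAdditive_iff, hcard, hQ, Finset.card_pair hqr]
      push_cast
      refine ⟨fun i _ => (hw_upper i).trans ?_, fun i hi => ?_⟩
      · exact one_div_le_one_div_of_le (by linarith) (by linarith)
      · have hip : i ≠ p := by
          rintro rfl
          simp [hqp.symm, hrp.symm] at hi
        rw [hw_ne i hip]
        exact one_div_le_one_div_of_le hn1 (by linarith)
    refine ⟨_, hNE, ?_⟩
    rw [totalProfit_unitAdditive, if_neg (hne_bounds _ hNE).1, hQ, Finset.sum_pair hqr,
      hw_ne q hqp, hw_ne r hrp]
    ring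
  · intro S hS
    obtain ⟨h₀, -, h₂⟩ := hne_bounds S hS
    rw [totalProfit_unitAdditive, if_neg h₀]
    have h₂' : ((Qset S 1).card : ℝ) ≤ 2 := by exact_mod_cast h₂
    have := (hsum_le (Qset S 1)).trans
      (mul_le_mul_of_nonneg_right h₂' (one_div_nonneg.mpr hn1.le))
    rw [mul_one_div] at this
    linarith
  · field_simp
    ring
  · have : (n : ℝ) - 1 + 2 ≠ 0 := by linarith
    field_simp
    ring
end
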